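/- arXiv:1508.02962 — 3 statements merged into one kernel-verified Lean document; each statement's English description precedes it below -/
import Mathlib

section
/- Let F be a cone subequation on ℝⁿ with dual subequation F̃ = {A ∈ Sym²(ℝⁿ) : −A ∉ Int F}, and for a unit vector e let P_e denote orthogonal projection onto the line ℝe. Then the following are equivalent: (i) −P_e ∉ F for every unit vector e (condition (F3)); (ii) P_e ∈ Int F̃ for every unit vector e; (iii) for every B ∈ Sym²(ℝⁿ) and every unit vector e there exists t₀ ∈ ℝ such that B + t·P_e ∈ Int F̃ for all t ≥ t₀ (the condition expressing that all smooth boundaries are strictly F̃-convex). -/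
open scoped Topology Classical
open Filter

noncomputable section

/-- Euclidean space ℝⁿ. -/
abbrev EucSp (n : ℕ) := EuclideanSpace ℝ (Fin n)

/-- The space Sym²(ℝⁿ) of symmetric real n×n matrices, with its subspace topology. -/
abbrev SymMat (n : ℕ) := selfAdjoint (Matrix (Fin n) (Fin n) ℝ)

variable {n : ℕ}

/-- The matrix of the orthogonal projection onto the line ℝ·e (for a unit vector e). -/
def projMat (e : EucSp n) : Matrix (Fin n) (Fin n) ℝ := Matrix.of fun i j => e i * e j

lemma projMat_selfAdjoint (e : EucSp n) :
    projMat e ∈ selfAdjoint (Matrix (Fin n) (Fin n) ℝ) := by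
  rw [selfAdjoint.mem_iff]
  ext i j
  simp [projMat, Matrix.star_apply, mul_comm]

/-- P_e, the projection onto ℝ·e, as an element of Sym²(ℝⁿ). -/
def symProj (e : EucSp n) : SymMat n := ⟨projMat e, projMat_selfAdjoint e⟩

/-- The matrix P_{e⊥} − (p−1)·P_e. -/
def charMatM (p : ℝ) (e : EucSp n) : Matrix (Fin n) (Fin n) ℝ :=
  (1 - projMat e) - (p - 1) • projMat e

lemma charMatM_selfAdjoint (p : ℝ) (e : EucSp n) :
    charMatM p e ∈ selfAdjoint (Matrix (Fin n) (Fin n) ℝ) := by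
  have h := projMat_selfAdjoint e
  rw [selfAdjoint.mem_iff] at h ⊢
  simp [charMatM, star_sub, star_smul, star_one, h]

/-- P_{e⊥} − (p−1)·P_e as an element of Sym²(ℝⁿ). -/
def charMat (p : ℝ) (e : EucSp n) : SymMat n := ⟨charMatM p e, charMatM_selfAdjoint p e⟩

/-- A (constant coefficient, pure second order) cone subequation on ℝⁿ: a nonempty,
closed, proper subset of Sym²(ℝⁿ) satisfying positivity (F1) and the cone property (F2). -/
structure ConeSubequation (n : ℕ) where
  carrier : Set (SymMat n)
  nonempty' : carrier.Nonempty
  proper' : carrier ≠ Set.univ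
  isClosed' : IsClosed carrier
  f1 : ∀ A ∈ carrier, ∀ P : SymMat n, (P : Matrix (Fin n) (Fin n) ℝ).PosSemidef → A + P ∈ carrier
  f2 : ∀ A ∈ carrier, ∀ t : ℝ, 0 < t → t • A ∈ carrier

/-- The dual of a set of symmetric matrices: F̃ = {A : −A ∉ Int F}. -/
def dualSet (S : Set (SymMat n)) : Set (SymMat n) := {A | -A ∉ interior S}

/-- The subequation P = {A ≥ 0} of positive semidefinite matrices. -/
def PosP (n : ℕ) : Set (SymMat n) := {A | (A : Matrix (Fin n) (Fin n) ℝ).PosSemidef}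

/-- The Hessian matrix (D²f)(x) of a real function on ℝⁿ. -/
def hessMatrix (f : EucSp n → ℝ) (x : EucSp n) : Matrix (Fin n) (Fin n) ℝ :=
  Matrix.of fun i j =>
    iteratedFDeriv ℝ 2 f x ![EuclideanSpace.single i 1, EuclideanSpace.single j 1]

/-- ψ is a test function for u at x₀ (relative to the set X): ψ is C² near x₀,
u ≤ ψ near x₀ (within X), and u(x₀) = ψ(x₀). -/
def IsTestAt (X : Set (EucSp n)) (u : EucSp n → EReal) (ψ : EucSp n → ℝ) (x₀ : EucSp n) :
    Prop :=
  ContDiffAt ℝ 2 ψ x₀ ∧ (∀ᶠ x in 𝓝[X] x₀, u x ≤ (ψ x : EReal)) ∧ u x₀ = (ψ x₀ : EReal)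

/-- u admits no test functions at x₀ (relative to X). -/
def NoTestAt (X : Set (EucSp n)) (u : EucSp n → EReal) (x₀ : EucSp n) : Prop :=
  ∀ ψ : EucSp n → ℝ, ¬ IsTestAt X u ψ x₀

/-- u is S-subharmonic on X (viscosity sense): u is upper semicontinuous on X with values
in [−∞,∞), and for every test function ψ for u at a point of X, the Hessian of ψ there
lies in S. -/
def FSubharmonicOn (S : Set (SymMat n)) (X : Set (EucSp n)) (u : EucSp n → EReal) : Prop :=
  UpperSemicontinuousOn u X ∧ (∀ x ∈ X, u x ≠ ⊤) ∧
    ∀ x₀ ∈ X, ∀ ψ : EucSp n → ℝ, IsTestAt X u ψ x₀ →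
      hessMatrix ψ x₀ ∈ Subtype.val '' S

/-- u is F-harmonic on X: u is F-subharmonic and −u is F̃-subharmonic on X. -/
def FHarmonicOn (F : ConeSubequation n) (X : Set (EucSp n)) (u : EucSp n → EReal) : Prop :=
  FSubharmonicOn F.carrier X u ∧ FSubharmonicOn (dualSet F.carrier) X (fun x => -u x)

/-- u is subaffine on X, i.e. P̃-subharmonic on X. -/
def SubaffineOn (X : Set (EucSp n)) (u : EucSp n → EReal) : Prop :=
  FSubharmonicOn (dualSet (PosP n)) X u

/-- h is a downward-pointing singular F-harmonic at x₀ on the neighborhood U: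
continuous, F-subharmonic on U, F-harmonic on U∖{x₀}, with a strict minimum at x₀, and
either of polar type (h(x₀) = −∞) or of finite type (h(x₀) > −∞, no test functions at x₀). -/
structure DPSingular (F : ConeSubequation n) (U : Set (EucSp n)) (x₀ : EucSp n)
    (h : EucSp n → EReal) : Prop where
  isOpen' : IsOpen U
  mem : x₀ ∈ U
  cont : ContinuousOn h U
  subh : FSubharmonicOn F.carrier U h
  harm : FHarmonicOn F (U \ {x₀}) h
  strictMin : ∀ x ∈ U, x ≠ x₀ → h x₀ < h x
  polarOrFinite : h x₀ = ⊥ ∨ (h x₀ ≠ ⊥ ∧ NoTestAt U h x₀)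

/-- Polar-case asymptotic equivalence H ≈ h at x₀: h − C ≤ H ≤ h + C near x₀. -/
def PolarAsymp (H : EucSp n → ℝ) (h : EucSp n → EReal) (x₀ : EucSp n) : Prop :=
  ∃ C : ℝ, ∀ᶠ x in 𝓝[≠] x₀, h x - (C : EReal) ≤ (H x : EReal) ∧ (H x : EReal) ≤ h x + (C : EReal)

/-- Finite-case asymptotic equivalence H ∼ h at x₀:
lim_{x→x₀} (H(x) − H(x₀))/(h(x) − h(x₀)) = 1. -/
def FiniteAsymp (H : EucSp n → ℝ) (h : EucSp n → EReal) (x₀ : EucSp n) : Prop :=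
  Tendsto (fun x => (H x - H x₀) / ((h x).toReal - (h x₀).toReal)) (𝓝[≠] x₀) (𝓝 1)

/-- Ω is a bounded domain: open, connected and bounded. -/
def IsBoundedDomain (Ω : Set (EucSp n)) : Prop :=
  IsOpen Ω ∧ IsConnected Ω ∧ Bornology.IsBounded Ω

/-- Condition (F3): −P_e ∉ F for every unit vector e. -/
def CondF3 (F : ConeSubequation n) : Prop :=
  ∀ e : EucSp n, ‖e‖ = 1 → -(symProj e) ∉ F.carrier

/-- The inward unit normal −∇ρ(x)/|∇ρ(x)| of the hypersurface {ρ = 0} bounding {ρ < 0}. -/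
def innerNormal (ρ : EucSp n → ℝ) (x : EucSp n) : EucSp n :=
  -(‖gradient ρ x‖⁻¹ • gradient ρ x)

/-- The second fundamental form of {ρ = 0} at x with respect to the inward normal,
extended by zero on the normal line: the tangential part of Hess ρ(x)/|∇ρ(x)|. -/
def secondFF (ρ : EucSp n → ℝ) (x : EucSp n) : Matrix (Fin n) (Fin n) ℝ :=
  ‖gradient ρ x‖⁻¹ •
    ((1 - projMat (innerNormal ρ x)) * hessMatrix ρ x * (1 - projMat (innerNormal ρ x)))

/-- Ω has smooth boundary which is strictly F-convex: Ω is globally defined by a smooth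
defining function ρ with nonvanishing gradient along ∂Ω, and at every boundary point
II_x + t·P_{ν(x)} ∈ Int F for all sufficiently large t. -/
def StrictlyConvexBoundary (F : ConeSubequation n) (Ω : Set (EucSp n)) : Prop :=
  ∃ ρ : EucSp n → ℝ, ContDiff ℝ (⊤ : ℕ∞) ρ ∧ Ω = {x | ρ x < 0} ∧
    ∀ x ∈ frontier Ω, gradient ρ x ≠ 0 ∧
      ∃ t₀ : ℝ, ∀ t ≥ t₀,
        secondFF ρ x + t • projMat (innerNormal ρ x) ∈ Subtype.val '' interior F.carrier

/-- F is invariant under O(n): gᵀ A g ∈ F for every orthogonal g and A ∈ F. -/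
def OrthInvariant (F : ConeSubequation n) : Prop :=
  ∀ g : Matrix (Fin n) (Fin n) ℝ, g.transpose * g = 1 →
    ∀ A ∈ F.carrier, ∀ B : SymMat n,
      (B : Matrix (Fin n) (Fin n) ℝ) = g.transpose * (A : Matrix (Fin n) (Fin n) ℝ) * g →
      B ∈ F.carrier

/-- F has Riesz characteristic p: P_{e⊥} − (p−1)P_e ∈ ∂F for every unit vector e. -/
def HasRieszChar (F : ConeSubequation n) (p : ℝ) : Prop :=
  ∀ e : EucSp n, ‖e‖ = 1 → charMat p e ∈ frontier F.carrier

/-- The Riesz kernel K_p. -/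
def rieszKernel (p : ℝ) (x : EucSp n) : ℝ :=
  if p = 2 then Real.log ‖x‖ else -(p - 2)⁻¹ * ‖x‖ ^ (2 - p)

instance : ContinuousSMul ℝ (SymMat n) where
  continuous_smul := Continuous.subtype_mk
    (continuous_fst.smul (continuous_subtype_val.comp continuous_snd)) _

open scoped Matrix in
/-- Symmetric matrices close to the identity are positive semidefinite. -/
lemma eventually_posSemidef_nhds_one (n : ℕ) :
    ∀ᶠ X : SymMat n in 𝓝 1, (X : Matrix (Fin n) (Fin n) ℝ).PosSemidef := by
  have hpos : (0 : ℝ) < 1 / (n + 1) := by positivity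
  have hentry : ∀ i j, ∀ᶠ X : SymMat n in 𝓝 1,
      |(X : Matrix (Fin n) (Fin n) ℝ) i j - (1 : Matrix (Fin n) (Fin n) ℝ) i j|
        < 1 / (n + 1) := by
    intro i j
    have hcont : Continuous fun X : SymMat n =>
        |(X : Matrix (Fin n) (Fin n) ℝ) i j - (1 : Matrix (Fin n) (Fin n) ℝ) i j| :=
      ((continuous_subtype_val.matrix_elem i j).sub continuous_const).abs
    exact hcont.continuousAt.eventually_lt continuousAt_const (by simpa using hpos)
  filter_upwards [eventually_all.2 fun i => eventually_all.2 (hentry i)] with X hX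
  refine Matrix.PosSemidef.of_dotProduct_mulVec_nonneg X.2 fun x => ?_
  have hterm : ∀ i j, (1 : Matrix (Fin n) (Fin n) ℝ) i j * (x i * x j)
      - 1 / (n + 1) * ((x i ^ 2 + x j ^ 2) / 2)
        ≤ (X : Matrix (Fin n) (Fin n) ℝ) i j * (x i * x j) := by
    intro i j
    have hxy : |x i * x j| ≤ (x i ^ 2 + x j ^ 2) / 2 :=
      abs_le.2 ⟨by nlinarith [sq_nonneg (x i + x j)], by nlinarith [sq_nonneg (x i - x j)]⟩
    have hmul := mul_le_mul (hX i j).le hxy (abs_nonneg _) hpos.le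
    rw [← abs_mul] at hmul
    linarith [neg_le_of_abs_le hmul]
  have hsum := Finset.sum_le_sum fun i (_ : i ∈ Finset.univ) =>
    Finset.sum_le_sum fun j (_ : j ∈ Finset.univ) => hterm i j
  have hlower : ∑ i, ∑ j, ((1 : Matrix (Fin n) (Fin n) ℝ) i j * (x i * x j)
      - 1 / (n + 1) * ((x i ^ 2 + x j ^ 2) / 2)) = 1 / (n + 1) * ∑ i, x i ^ 2 := by
    simp only [Finset.sum_sub_distrib, ← Finset.mul_sum, ← Finset.sum_div,
      Finset.sum_add_distrib, Matrix.one_apply, ite_mul, one_mul, zero_mul,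
      Finset.sum_ite_eq, Finset.mem_univ, if_true, Finset.sum_const, Finset.card_univ,
      Fintype.card_fin, nsmul_eq_mul, ← pow_two]
    field_simp
    ring
  have hform : star x ⬝ᵥ ((X : Matrix (Fin n) (Fin n) ℝ) *ᵥ x)
      = ∑ i, ∑ j, (X : Matrix (Fin n) (Fin n) ℝ) i j * (x i * x j) := by
    simp only [dotProduct, Matrix.mulVec, Finset.mul_sum, star_trivial]
    exact Finset.sum_congr rfl fun i _ => Finset.sum_congr rfl fun j _ => by ring
  rw [hform]
  exact (mul_nonneg hpos.le (Finset.sum_nonneg fun i _ => sq_nonneg _)).trans (hlower ▸ hsum)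

namespace ConeSubequation

/-- Adding a positive multiple of the identity moves a cone subequation into its interior. -/
lemma add_smul_one_mem_interior (F : ConeSubequation n) {A : SymMat n} (hA : A ∈ F.carrier)
    {ε : ℝ} (hε : 0 < ε) : A + ε • (1 : SymMat n) ∈ interior F.carrier := by
  rw [mem_interior_iff_mem_nhds]
  have hcont : Continuous fun X : SymMat n => ε⁻¹ • (X - A) := by fun_prop
  have hlim : Tendsto (fun X : SymMat n => ε⁻¹ • (X - A)) (𝓝 (A + ε • 1)) (𝓝 1) := by
    have := hcont.tendsto (A + ε • 1)
    rwa [add_sub_cancel_left, inv_smul_smul₀ hε.ne'] at this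
  filter_upwards [hlim.eventually (eventually_posSemidef_nhds_one n)] with X hX
  have hpos : ((X - A : SymMat n) : Matrix (Fin n) (Fin n) ℝ).PosSemidef := by
    have hval := hX.smul hε.le
    rwa [← selfAdjoint.val_smul, smul_inv_smul₀ hε.ne'] at hval
  simpa using F.f1 A hA (X - A) hpos

/-- A cone subequation is the closure of its interior. -/
lemma closure_interior_carrier (F : ConeSubequation n) :
    closure (interior F.carrier) = F.carrier := by
  refine (closure_minimal interior_subset F.isClosed').antisymm fun A hA => ?_
  have hcont : Continuous fun ε : ℝ => A + ε • (1 : SymMat n) := by fun_prop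
  have hlim : Tendsto (fun ε : ℝ => A + ε • (1 : SymMat n)) (𝓝[>] 0) (𝓝 A) := by
    simpa using (hcont.tendsto 0).mono_left nhdsWithin_le_nhds
  exact mem_closure_of_tendsto hlim
    (eventually_mem_nhdsWithin.mono fun ε hε => F.add_smul_one_mem_interior hA hε)

lemma mem_interior_dualSet_iff (F : ConeSubequation n) {A : SymMat n} :
    A ∈ interior (dualSet F.carrier) ↔ -A ∉ F.carrier := by
  have hdual : dualSet F.carrier = (Neg.neg ⁻¹' interior F.carrier)ᶜ := rfl
  have hneg := (Homeomorph.neg (SymMat n)).preimage_closure (interior F.carrier)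
  rw [Homeomorph.coe_neg, F.closure_interior_carrier] at hneg
  rw [hdual, interior_compl, ← hneg]
  rfl

lemma smul_mem_carrier_iff (F : ConeSubequation n) {A : SymMat n} {t : ℝ} (ht : 0 < t) :
    t • A ∈ F.carrier ↔ A ∈ F.carrier :=
  ⟨fun h => by simpa [smul_smul, ht.ne'] using F.f2 _ h t⁻¹ (inv_pos.2 ht),
    fun h => F.f2 A h t ht⟩

/-- The interior of the dual of a cone subequation is invariant under positive scaling. -/
lemma smul_mem_interior_dualSet_iff (F : ConeSubequation n) {A : SymMat n} {t : ℝ}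
    (ht : 0 < t) :
    t • A ∈ interior (dualSet F.carrier) ↔ A ∈ interior (dualSet F.carrier) := by
  rw [F.mem_interior_dualSet_iff, F.mem_interior_dualSet_iff, ← smul_neg,
    F.smul_mem_carrier_iff ht]

/-- A matrix lies in the interior of the dual cone exactly when all its sufficiently large
multiples absorb every perturbation. -/
lemma mem_interior_dualSet_iff_forall_exists (F : ConeSubequation n) {A : SymMat n} :
    A ∈ interior (dualSet F.carrier) ↔
      ∀ B : SymMat n, ∃ t₀ : ℝ, ∀ t ≥ t₀, B + t • A ∈ interior (dualSet F.carrier) := by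
  refine ⟨fun hA B => ?_, fun h => ?_⟩
  · have hlim : Tendsto (fun t : ℝ => t⁻¹ • B + A) atTop (𝓝 A) := by
      simpa using ((tendsto_inv_atTop_zero (𝕜 := ℝ)).smul_const B).add_const A
    refine eventually_atTop.1 ?_
    filter_upwards [hlim.eventually (isOpen_interior.mem_nhds hA), eventually_gt_atTop 0]
      with t ht hpos
    simpa [smul_smul, hpos.ne'] using (F.smul_mem_interior_dualSet_iff hpos).2 ht
  · obtain ⟨t₀, ht₀⟩ := h 0
    have ht := ht₀ (max t₀ 1) (le_max_left _ _)
    rwa [zero_add, F.smul_mem_interior_dualSet_iff (lt_max_of_lt_right one_pos)] at ht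

end ConeSubequation

/-- For a cone subequation F, the conditions (F3), (F3)⁽ⁱᵛ⁾ and (F3)''' are
equivalent: −P_e ∉ F for all unit e; P_e ∈ Int F̃ for all unit e; and for every B ∈ Sym²(ℝⁿ)
and unit e, B + t·P_e ∈ Int F̃ for all t ≥ some t₀. -/
theorem dirichlet_singularities_stmt0 {n : ℕ} (F : ConeSubequation n) :
    ((∀ e : EucSp n, ‖e‖ = 1 → -(symProj e) ∉ F.carrier) ↔
      (∀ e : EucSp n, ‖e‖ = 1 → symProj e ∈ interior (dualSet F.carrier))) ∧
    ((∀ e : EucSp n, ‖e‖ = 1 → symProj e ∈ interior (dualSet F.carrier)) ↔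
      (∀ B : SymMat n, ∀ e : EucSp n, ‖e‖ = 1 →
        ∃ t₀ : ℝ, ∀ t ≥ t₀, B + t • symProj e ∈ interior (dualSet F.carrier))) := by
  refine ⟨forall₂_congr fun e _ => F.mem_interior_dualSet_iff.symm,
    fun h B e he => F.mem_interior_dualSet_iff_forall_exists.1 (h e he) B,
    fun h e he => F.mem_interior_dualSet_iff_forall_exists.2 fun B => h B e he⟩
end
end

section
/- Let F be a cone subequation on ℝⁿ that is invariant under a subgroup H ⊆ O(n) acting transitively on the unit sphere S^{n−1} (i.e., gᵀAg ∈ F for all g ∈ H and A ∈ F). For a unit vector e set p(e) = sup{q ∈ ℝ : P_{e⊥} − (q−1)P_e ∈ F}. Then p(e) is independent of the unit vector e; if the common value p is finite, then F has Riesz characteristic p, i.e. P_{e⊥} − (p−1)P_e ∈ ∂F for every unit vector e; and the common value is +∞ if and only if −P_e ∈ F for every unit vector e (i.e., condition (F3) fails). -/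
open scoped Topology Classical
open Filter

noncomputable section

variable {n : ℕ}

lemma charMatM_eq (q : ℝ) (e : EucSp n) : charMatM q e = 1 - q • projMat e := by
  simp only [charMatM, sub_smul, one_smul]
  abel

lemma charMat_eq (q : ℝ) (e : EucSp n) : charMat q e = 1 - q • symProj e :=
  Subtype.ext (charMatM_eq q e)

lemma projMat_eq_vecMulVec (e : EucSp n) : projMat e = Matrix.vecMulVec e e := by
  ext i j
  simp [projMat, Matrix.vecMulVec_apply]

lemma posSemidef_projMat (e : EucSp n) : (projMat e).PosSemidef := by
  rw [projMat_eq_vecMulVec]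
  simpa using Matrix.posSemidef_vecMulVec_self_star (R := ℝ) (n := Fin n) e

lemma transpose_mul_charMatM_mul {g : Matrix (Fin n) (Fin n) ℝ} (hg : g.transpose * g = 1)
    {e f : EucSp n} (hgf : g.mulVec e = f) (q : ℝ) :
    charMatM q e = g.transpose * charMatM q f * g := by
  have he : Matrix.mulVec g.transpose f = e := by
    rw [← hgf, Matrix.mulVec_mulVec, hg, Matrix.one_mulVec]
  have hP : g.transpose * projMat f * g = projMat e := by
    rw [projMat_eq_vecMulVec, projMat_eq_vecMulVec, Matrix.mul_vecMulVec, Matrix.vecMulVec_mul,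
      ← Matrix.mulVec_transpose, he]
  rw [charMatM_eq, charMatM_eq, mul_sub, sub_mul, mul_one, hg, Matrix.mul_smul, Matrix.smul_mul, hP]

lemma continuous_charMat (e : EucSp n) : Continuous fun q : ℝ => charMat q e := by
  refine Continuous.subtype_mk ?_ _
  unfold charMatM
  fun_prop

namespace ConeSubequation

lemma zero_mem (F : ConeSubequation n) : (0 : SymMat n) ∈ F.carrier := by
  obtain ⟨A, hA⟩ := F.nonempty'
  have hc : Continuous fun t : ℝ => t • A := by
    refine Continuous.subtype_mk (f := fun t : ℝ => t • (A : Matrix (Fin n) (Fin n) ℝ)) ?_ _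
    fun_prop
  have ht : Tendsto (fun t : ℝ => t • A) (𝓝[>] 0) (𝓝 0) := by
    simpa using (hc.tendsto 0).mono_left nhdsWithin_le_nhds
  refine F.isClosed'.mem_of_tendsto ht ?_
  filter_upwards [self_mem_nhdsWithin] with t ht
  exact F.f2 A hA t ht

lemma mem_of_posSemidef (F : ConeSubequation n) {A : SymMat n}
    (hA : (A : Matrix (Fin n) (Fin n) ℝ).PosSemidef) : A ∈ F.carrier := by
  simpa using F.f1 0 F.zero_mem A hA

lemma charMat_zero_mem (F : ConeSubequation n) (e : EucSp n) : charMat 0 e ∈ F.carrier :=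
  F.mem_of_posSemidef (by
    simpa [charMat, charMatM_eq] using Matrix.PosSemidef.one)

lemma charMat_mem_of_le (F : ConeSubequation n) {e : EucSp n} {q r : ℝ} (hqr : q ≤ r)
    (hr : charMat r e ∈ F.carrier) : charMat q e ∈ F.carrier := by
  have h := F.f1 _ hr ((r - q) • symProj e)
    ((posSemidef_projMat e).smul (sub_nonneg.mpr hqr))
  rw [charMat_eq, sub_smul, sub_add_sub_cancel] at h
  rwa [charMat_eq]

lemma charMat_sSup_mem_frontier (F : ConeSubequation n) {e : EucSp n}
    (h : BddAbove {q : ℝ | charMat q e ∈ F.carrier}) :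
    charMat (sSup {q : ℝ | charMat q e ∈ F.carrier}) e ∈ frontier F.carrier := by
  set S := {q : ℝ | charMat q e ∈ F.carrier}
  have hmem : sSup S ∈ S :=
    (F.isClosed'.preimage (continuous_charMat e)).csSup_mem ⟨0, F.charMat_zero_mem e⟩ h
  refine ⟨subset_closure hmem, fun hint => ?_⟩
  have hev : ∀ᶠ q in 𝓝[>] sSup S, charMat q e ∈ F.carrier :=
    (((continuous_charMat e).tendsto _).eventually
      (mem_interior_iff_mem_nhds.mp hint)).filter_mono nhdsWithin_le_nhds
  obtain ⟨q, hq, hlt⟩ := (hev.and self_mem_nhdsWithin).exists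
  exact (le_csSup h hq).not_gt hlt

lemma not_bddAbove_iff_neg_symProj_mem (F : ConeSubequation n) (e : EucSp n) :
    ¬ BddAbove {q : ℝ | charMat q e ∈ F.carrier} ↔ -(symProj e) ∈ F.carrier := by
  constructor
  · intro h
    have hc : Continuous fun t : ℝ => t • (1 : SymMat n) - symProj e := by
      refine Continuous.subtype_mk
        (f := fun t : ℝ => t • (1 : Matrix (Fin n) (Fin n) ℝ) - projMat e) ?_ _
      fun_prop
    have ht : Tendsto (fun t : ℝ => t • (1 : SymMat n) - symProj e) (𝓝[>] 0)
        (𝓝 (-(symProj e))) := by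
      simpa using (hc.tendsto 0).mono_left nhdsWithin_le_nhds
    refine F.isClosed'.mem_of_tendsto ht ?_
    filter_upwards [self_mem_nhdsWithin] with t (ht : 0 < t)
    obtain ⟨r, hr, hlt⟩ := not_bddAbove_iff.mp h t⁻¹
    have hmem := F.f2 _ (F.charMat_mem_of_le hlt.le hr) t ht
    rwa [charMat_eq, smul_sub, smul_smul, mul_inv_cancel₀ ht.ne', one_smul] at hmem
  · intro h
    refine not_bddAbove_iff.mpr fun b => ⟨max b 0 + 1, ?_, by
      linarith [le_max_left b 0]⟩
    have hpos : 0 < max b 0 + 1 := by positivity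
    have hmem := F.f1 _ (F.f2 _ h _ hpos) 1 Matrix.PosSemidef.one
    rwa [smul_neg, neg_add_eq_sub, ← charMat_eq] at hmem

end ConeSubequation

/-- for a cone subequation invariant under a subgroup H ⊆ O(n) acting
transitively on the unit sphere, the set {q : P_{e⊥} − (q−1)P_e ∈ F} is independent of the
unit vector e; if it is bounded above then its supremum p is a Riesz characteristic
(P_{e⊥} − (p−1)P_e ∈ ∂F for all unit e); and it is unbounded above iff −P_e ∈ F for all
unit e (i.e. (F3) fails). -/
theorem dirichlet_singularities_stmt2 {n : ℕ} (F : ConeSubequation n)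
    (H : Set (Matrix (Fin n) (Fin n) ℝ))
    (horth : ∀ g ∈ H, g.transpose * g = 1)
    (hone : (1 : Matrix (Fin n) (Fin n) ℝ) ∈ H)
    (hmul : ∀ g ∈ H, ∀ g' ∈ H, g * g' ∈ H)
    (hinvcl : ∀ g ∈ H, g.transpose ∈ H)
    (htrans : ∀ e f : EucSp n, ‖e‖ = 1 → ‖f‖ = 1 → ∃ g ∈ H, g.mulVec e = f)
    (hFinv : ∀ g ∈ H, ∀ A ∈ F.carrier, ∀ B : SymMat n,
      (B : Matrix (Fin n) (Fin n) ℝ) = g.transpose * (A : Matrix (Fin n) (Fin n) ℝ) * g →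
      B ∈ F.carrier) :
    (∀ e f : EucSp n, ‖e‖ = 1 → ‖f‖ = 1 →
      {q : ℝ | charMat q e ∈ F.carrier} = {q : ℝ | charMat q f ∈ F.carrier}) ∧
    (∀ e : EucSp n, ‖e‖ = 1 → BddAbove {q : ℝ | charMat q e ∈ F.carrier} →
      ∀ f : EucSp n, ‖f‖ = 1 →
        charMat (sSup {q : ℝ | charMat q e ∈ F.carrier}) f ∈ frontier F.carrier) ∧
    (∀ e : EucSp n, ‖e‖ = 1 →
      (¬ BddAbove {q : ℝ | charMat q e ∈ F.carrier} ↔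
        ∀ f : EucSp n, ‖f‖ = 1 → -(symProj f) ∈ F.carrier)) := by
  have hind : ∀ e f : EucSp n, ‖e‖ = 1 → ‖f‖ = 1 →
      {q : ℝ | charMat q e ∈ F.carrier} = {q : ℝ | charMat q f ∈ F.carrier} := by
    have hsub : ∀ e f : EucSp n, ‖e‖ = 1 → ‖f‖ = 1 →
        {q : ℝ | charMat q f ∈ F.carrier} ⊆ {q : ℝ | charMat q e ∈ F.carrier} := by
      intro e f he hf q hq
      obtain ⟨g, hg, hgf⟩ := htrans e f he hf
      exact hFinv g hg _ hq _ (transpose_mul_charMatM_mul (horth g hg) hgf q)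
    exact fun e f he hf => (hsub f e hf he).antisymm (hsub e f he hf)
  refine ⟨hind, fun e he hb f hf => ?_, fun e he => ⟨fun h f hf => ?_, fun h => ?_⟩⟩
  · rw [hind e f he hf] at hb ⊢
    exact F.charMat_sSup_mem_frontier hb
  · rw [hind e f he hf] at h
    exact (F.not_bddAbove_iff_neg_symProj_mem f).mp h
  · exact (F.not_bddAbove_iff_neg_symProj_mem e).mpr (h e he)
end
end

section
/- Let F be a cone subequation on ℝⁿ, Ω ⊂ ℝⁿ a bounded domain, x₁,…,x_k ∈ Ω distinct points, φ ∈ C(∂Ω), and for each j let h_j be a downward-pointing singular F-harmonic at x_j (each of polar type or of finite type). Then there is at most one function H, continuous on Ω̄ ∖ {x₁,…,x_k} (and extended to each finite-type point x_j by H(x_j) = limsup_{x→x_j} H(x)), such that: H is F-harmonic on Ω ∖ {x₁,…,x_k}; H = φ on ∂Ω; H ≈ h_j at each x_j of polar type; and H ∼ h_j at each x_j of finite type. -/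
open scoped Topology Classical
open Filter

noncomputable section

variable {n : ℕ}

/-- H solves the Dirichlet problem with prescribed singularities: H is continuous on
Ω̄ ∖ {x₁,…,x_k}, F-harmonic on Ω ∖ {x₁,…,x_k}, equals φ on ∂Ω, is ≈ h_j at polar-type
points and (with value given by the limsup) ∼ h_j at finite-type points. -/
def IsDPPSSolution {n k : ℕ} (F : ConeSubequation n) (Ω : Set (EucSp n))
    (x : Fin k → EucSp n) (φ : EucSp n → ℝ) (h : Fin k → EucSp n → EReal)
    (H : EucSp n → ℝ) : Prop :=
  ContinuousOn H (closure Ω \ Set.range x) ∧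
  FHarmonicOn F (Ω \ Set.range x) (fun y => (H y : EReal)) ∧
  (∀ y ∈ frontier Ω, H y = φ y) ∧
  (∀ j, h j (x j) = ⊥ → PolarAsymp H (h j) (x j)) ∧
  (∀ j, h j (x j) ≠ ⊥ →
    H (x j) = Filter.limsup H (𝓝[≠] (x j)) ∧ FiniteAsymp H (h j) (x j))

lemma exists_convex_envelope {E : Type*} [NormedAddCommGroup E] [NormedSpace ℝ E]
    {g F : E → ℝ} {M : ℝ} (hF : ConvexOn ℝ Set.univ F) (hFg : ∀ x, F x ≤ g x)
    (hg : ∀ x h, g (x + h) + g (x - h) - 2 * g x ≤ M * ‖h‖ ^ 2) :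
    ∃ w : E → ℝ, ConvexOn ℝ Set.univ w ∧ (∀ x, w x ≤ g x) ∧
      (∀ G : E → ℝ, ConvexOn ℝ Set.univ G → (∀ x, G x ≤ g x) → ∀ x, G x ≤ w x) ∧
      ∀ x h, w (x + h) + w (x - h) - 2 * w x ≤ M * ‖h‖ ^ 2 := by
  set S : Type _ := {G : E → ℝ // ConvexOn ℝ Set.univ G ∧ ∀ x, G x ≤ g x}
  have : Nonempty S := ⟨⟨F, hF, hFg⟩⟩
  have hbdd : ∀ x, BddAbove (Set.range fun G : S => G.1 x) := fun x =>
    ⟨g x, by rintro _ ⟨G, rfl⟩; exact G.2.2 x⟩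
  have hle : ∀ (G : S) x, G.1 x ≤ ⨆ G : S, G.1 x := fun G x => le_ciSup (hbdd x) G
  have hconv : ConvexOn ℝ Set.univ fun x => ⨆ G : S, G.1 x := by
    refine ⟨convex_univ, fun x _ y _ a b ha hb hab => ciSup_le fun G => ?_⟩
    refine (G.2.1.2 (Set.mem_univ x) (Set.mem_univ y) ha hb hab).trans ?_
    exact add_le_add (smul_le_smul_of_nonneg_left (hle G x) ha)
      (smul_le_smul_of_nonneg_left (hle G y) hb)
  have hwg : ∀ x, (⨆ G : S, G.1 x) ≤ g x := fun x => ciSup_le fun G => G.2.2 x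
  refine ⟨fun x => ⨆ G : S, G.1 x, hconv, hwg, fun G h1 h2 x => hle ⟨G, h1, h2⟩ x,
    fun x h => ?_⟩
  have h1 : ConvexOn ℝ Set.univ fun y => (1 / 2 : ℝ) • ((⨆ G : S, G.1 (y + h)) +
      ⨆ G : S, G.1 (y + -h)) + -(M * ‖h‖ ^ 2 / 2) := by
    have e1 := hconv.translate_left h
    have e2 := hconv.translate_left (-h)
    simp only [Set.preimage_univ] at e1 e2
    exact ((e1.add e2).smul (by norm_num : (0 : ℝ) ≤ 1 / 2)).add_const _
  have h2 := hle ⟨_, h1, fun y => by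
    have := hg y h
    have e1 := hwg (y + h)
    have e2 := hwg (y + -h)
    rw [← sub_eq_add_neg] at e2
    simp only [smul_eq_mul, ← sub_eq_add_neg y]
    linarith⟩ x
  simp only [smul_eq_mul, ← sub_eq_add_neg x] at h2
  linarith

lemma ConvexOn.exists_subgradient {E : Type*} [NormedAddCommGroup E] [NormedSpace ℝ E]
    [FiniteDimensional ℝ E] {w : E → ℝ} (hw : ConvexOn ℝ Set.univ w) (x : E) :
    ∃ p : E →L[ℝ] ℝ, ∀ y, w x + p (y - x) ≤ w y := by
  have hc : Continuous w := hw.locallyLipschitz.continuous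
  have hs := hw.convex_strict_epigraph
  have ho : IsOpen {q : E × ℝ | q.1 ∈ Set.univ ∧ w q.1 < q.2} := by
    simpa using isOpen_lt (hc.comp continuous_fst) continuous_snd
  obtain ⟨f, hf⟩ := geometric_hahn_banach_open_point (x := (x, w x)) hs ho (by simp)
  have hsplit : ∀ (y : E) (t : ℝ), f (y, t) = f (y, 0) + t * f (0, 1) := fun y t => by
    have : (y, t) = (y, (0 : ℝ)) + t • ((0 : E), (1 : ℝ)) := by simp
    rw [this, map_add, map_smul, smul_eq_mul]
  have hneg : f (0, 1) < 0 := by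
    have := hf (x, w x + 1) (by simp)
    rw [hsplit, hsplit x (w x)] at this
    linarith
  set c := -f (0, 1) with hc'
  have hcpos : 0 < c := by linarith
  refine ⟨c⁻¹ • f.comp (ContinuousLinearMap.inl ℝ E ℝ), fun y => ?_⟩
  have key : f (y - x, 0) ≤ c * (w y - w x) := by
    refine le_of_forall_pos_le_add fun ε hε => ?_
    have := hf (y, w y + ε / c) (by simpa using by positivity)
    rw [hsplit, hsplit x (w x)] at this
    have e : f (y - x, 0) = f (y, 0) - f (x, 0) := by rw [← map_sub]; simp
    have : (w y + ε / c) * c = w y * c + ε := by field_simp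
    nlinarith
  have : c⁻¹ * f (y - x, 0) ≤ w y - w x := by
    rw [inv_mul_le_iff₀ hcpos]; exact key
  simp only [smul_apply, ContinuousLinearMap.comp_apply,
    ContinuousLinearMap.inl_apply, smul_eq_mul]
  linarith

lemma ConvexOn.exists_lipschitz_gradient {E : Type*} [NormedAddCommGroup E]
    [InnerProductSpace ℝ E] [FiniteDimensional ℝ E] {w : E → ℝ} {M : ℝ} (hM : 0 ≤ M)
    (hw : ConvexOn ℝ Set.univ w)
    (hsc : ∀ x h, w (x + h) + w (x - h) - 2 * w x ≤ M * ‖h‖ ^ 2) :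
    ∃ p : E → E, LipschitzWith (2 * M).toNNReal p ∧
      (∀ x, HasFDerivAt w (innerSL ℝ (p x)) x) ∧ ∀ x y, w x + inner ℝ (p x) (y - x) ≤ w y := by
  have hex : ∀ x, ∃ p : E, ∀ y, w x + inner ℝ p (y - x) ≤ w y := fun x => by
    obtain ⟨p, hp⟩ := hw.exists_subgradient x
    exact ⟨(InnerProductSpace.toDual ℝ E).symm p, fun y => by
      rw [InnerProductSpace.toDual_symm_apply]; exact hp y⟩
  choose p hp using hex
  have hup : ∀ x h, w (x + h) ≤ w x + inner ℝ (p x) h + M * ‖h‖ ^ 2 := fun x h => by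
    have h1 := hsc x h
    have h2 := hp x (x - h)
    have e : x - h - x = -h := by abel
    rw [e, inner_neg_right] at h2
    linarith
  refine ⟨p, LipschitzWith.of_dist_le_mul fun x y => ?_, fun x => ?_, hp⟩
  · rw [Real.coe_toNNReal _ (by positivity), dist_eq_norm, dist_eq_norm]
    rcases eq_or_ne (p x) (p y) with heq | hne
    · rw [heq, sub_self, norm_zero]; positivity
    have hd : 0 < ‖p x - p y‖ := norm_pos_iff.2 (sub_ne_zero.2 hne)
    rcases eq_or_ne x y with heq | hxy
    · exact absurd (by rw [heq]) hne
    have hr : 0 < ‖x - y‖ := norm_pos_iff.2 (sub_ne_zero.2 hxy)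
    set h : E := (‖x - y‖ / ‖p x - p y‖) • (p x - p y) with hh
    have hn : ‖h‖ = ‖x - y‖ := by
      rw [hh, norm_smul, Real.norm_of_nonneg (by positivity)]; field_simp
    have h1 := hup y h
    have h2 := hp x (y + h)
    have h3 := hup x (y - x)
    have e : inner ℝ (p x) h - inner ℝ (p y) h = ‖x - y‖ * ‖p x - p y‖ := by
      rw [← inner_sub_left, hh, inner_smul_right, real_inner_self_eq_norm_sq]; field_simp
    have e2 : y + h - x = (y - x) + h := by abel
    rw [e2, inner_add_right] at h2
    rw [add_sub_cancel, norm_sub_rev] at h3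
    rw [hn] at h1
    have : ‖x - y‖ * ‖p x - p y‖ ≤ ‖x - y‖ * (2 * M * ‖x - y‖) := by nlinarith
    exact le_of_mul_le_mul_left this hr
  · rw [hasFDerivAt_iff_isLittleO_nhds_zero]
    have hO : (fun h => w (x + h) - w x - innerSL ℝ (p x) h) =O[𝓝 0] fun h => ‖h‖ ^ 2 := by
      refine Asymptotics.IsBigO.of_bound M (Eventually.of_forall fun h => ?_)
      have h1 := hup x h
      have h2 := hp x (x + h)
      rw [add_sub_cancel_left] at h2
      rw [Real.norm_eq_abs, innerSL_apply_apply, Real.norm_of_nonneg (by positivity), abs_le]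
      constructor <;> nlinarith [mul_nonneg hM (sq_nonneg ‖h‖)]
    exact hO.trans_isLittleO (Asymptotics.isLittleO_norm_pow_id one_lt_two)

lemma second_order_expansion {E : Type*} [NormedAddCommGroup E] [InnerProductSpace ℝ E]
    {w : E → ℝ} {p : E → E} {A : E →L[ℝ] E} {x : E}
    (hw : ∀ y, HasFDerivAt w (innerSL ℝ (p y)) y) (hp : HasFDerivAt p A x) :
    (∀ h k, inner ℝ (A h) k = inner ℝ h (A k)) ∧ ∀ η > 0, ∀ᶠ h in 𝓝 (0 : E),
      |w (x + h) - w x - inner ℝ (p x) h - inner ℝ (A h) h / 2| ≤ η * ‖h‖ ^ 2 := by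
  have hsymm : ∀ h k, inner ℝ (A h) k = inner ℝ h (A k) := fun h k => by
    have : inner ℝ (A h) k = inner ℝ (A k) h :=
      second_derivative_symmetric hw ((innerSL ℝ).hasFDerivAt.comp x hp) h k
    rw [this, real_inner_comm]
  refine ⟨hsymm, fun η hη => ?_⟩
  have hlo := (hasFDerivAt_iff_isLittleO_nhds_zero.1 hp).def hη
  obtain ⟨r, hr, hball⟩ := Metric.eventually_nhds_iff_ball.1 hlo
  refine Metric.eventually_nhds_iff_ball.2 ⟨r, hr, fun h hh => ?_⟩
  have hder : ∀ y ∈ Metric.closedBall (0 : E) ‖h‖, HasFDerivWithinAt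
      (fun k => w (x + k) - inner ℝ (p x) k - inner ℝ (A k) k / 2)
      (innerSL ℝ (p (x + y) - p x - A y)) (Metric.closedBall (0 : E) ‖h‖) y := fun y _ => by
    have h1 : HasFDerivAt (fun k => w (x + k)) (innerSL ℝ (p (x + y))) y := by
      exact (hw (x + y)).comp y ((hasFDerivAt_id y).const_add x)
    have h2 : HasFDerivAt (fun k => inner ℝ (p x) k) (innerSL ℝ (p x)) y :=
      (innerSL ℝ (p x)).hasFDerivAt
    have h3 := (A.hasFDerivAt (x := y)).inner ℝ (hasFDerivAt_id y)
    have h4 := ((h1.sub h2).sub (h3.mul_const (1 / 2)))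
    refine (h4.congr_fderiv ?_).hasFDerivWithinAt.congr_of_eventuallyEq ?_ ?_
    · ext k
      simp [fderivInnerCLM_apply, hsymm k y]
      rw [real_inner_comm k (A y)]
      ring
    · exact Eventually.of_forall fun k => by simp; ring
    · simp; ring
  have hbd : ∀ y ∈ Metric.closedBall (0 : E) ‖h‖,
      ‖innerSL ℝ (p (x + y) - p x - A y)‖ ≤ η * ‖h‖ := fun y hy => by
    rw [innerSL_apply_norm]
    have hy' : ‖y‖ ≤ ‖h‖ := by simpa using hy
    have hh' : ‖h‖ < r := by simpa using hh
    refine (hball y (by simpa using hy'.trans_lt hh')).trans ?_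
    gcongr
  have := (convex_closedBall (0 : E) ‖h‖).norm_image_sub_le_of_norm_hasFDerivWithin_le hder hbd
    (by simp : (0 : E) ∈ _) (by simp : h ∈ _)
  simp only [sub_zero, map_zero, inner_zero_right, zero_div, add_zero] at this
  rw [Real.norm_eq_abs] at this
  convert this using 1
  · congr 1; ring
  · ring

open MeasureTheory Measure in
lemma LipschitzWith.exists_mem_differentiableAt {E : Type*} [NormedAddCommGroup E]
    [InnerProductSpace ℝ E] [FiniteDimensional ℝ E] {P Q : E → E} {C D : NNReal}
    (hP : LipschitzWith C P) (hQ : LipschitzWith D Q) {S : Set E} {c : E} {r : ℝ} (hr : 0 < r)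
    (hS : Metric.ball c r ⊆ P '' S) : ∃ x ∈ S, DifferentiableAt ℝ Q x := by
  by_contra! hcon
  let _ : MeasurableSpace E := borel E
  have : BorelSpace E := ⟨rfl⟩
  have hae := hQ.ae_differentiableAt (μ := (μH[Module.finrank ℝ E] : Measure E))
  have hnull : (μH[Module.finrank ℝ E] : Measure E) S = 0 :=
    measure_mono_null (fun x hx => hcon x hx) hae
  have h1 := hP.hausdorffMeasure_image_le (d := Module.finrank ℝ E) (by positivity) S
  rw [hnull, mul_zero] at h1
  have h2 := (measure_mono hS).trans h1
  exact absurd h2 (not_le.2 (Metric.measure_ball_pos _ c hr))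

/-- The sup-convolution of `u` over the set `B`, with quadratic kernel of opening `N`. -/
def supConvolution {E : Type*} [NormedAddCommGroup E] (N : ℝ) (B : Set E) (u : E → ℝ) (z : E) :
    ℝ := ⨆ x : B, (u x - N * ‖z - x‖ ^ 2)

section SupConvolution

variable {E : Type*} [NormedAddCommGroup E] {N m : ℝ} {B : Set E} {u : E → ℝ}

lemma le_supConvolution (hN : 0 ≤ N) (hu : ∀ x ∈ B, u x ≤ m) {x : E} (hx : x ∈ B) (z : E) :
    u x - N * ‖z - x‖ ^ 2 ≤ supConvolution N B u z :=
  le_ciSup (f := fun x : B => u x - N * ‖z - x‖ ^ 2) ⟨m, by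
    rintro _ ⟨y, rfl⟩
    have := hu y y.2
    have : 0 ≤ N * ‖z - y‖ ^ 2 := by positivity
    dsimp only
    linarith⟩ ⟨x, hx⟩

lemma supConvolution_le (hB : B.Nonempty) {z : E} {c : ℝ}
    (h : ∀ x ∈ B, u x - N * ‖z - x‖ ^ 2 ≤ c) : supConvolution N B u z ≤ c := by
  have := hB.to_subtype
  exact ciSup_le fun x => h x x.2

variable [InnerProductSpace ℝ E]

lemma convexOn_supConvolution_add (hN : 0 ≤ N) (hB : B.Nonempty) (hu : ∀ x ∈ B, u x ≤ m) :
    ConvexOn ℝ Set.univ fun z => supConvolution N B u z + N * ‖z‖ ^ 2 := by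
  refine ⟨convex_univ, fun x _ y _ a b ha hb hab => ?_⟩
  rw [← le_sub_iff_add_le]
  refine supConvolution_le hB fun k hk => ?_
  have h1 := mul_le_mul_of_nonneg_left (le_supConvolution hN hu hk x) ha
  have h2 := mul_le_mul_of_nonneg_left (le_supConvolution hN hu hk y) hb
  simp only [smul_eq_mul]
  have e : ∀ z : E, ‖z - k‖ ^ 2 = ‖z‖ ^ 2 - 2 * inner ℝ z k + ‖k‖ ^ 2 :=
    fun z => norm_sub_sq_real z k
  rw [e] at h1 h2 ⊢
  rw [inner_add_left, inner_smul_left, inner_smul_left]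
  simp only [conj_trivial]
  obtain rfl : b = 1 - a := by linarith
  linarith

lemma supConvolution_add_sub (hN : 0 ≤ N) (hB : B.Nonempty) (hu : ∀ x ∈ B, u x ≤ m) (z h : E) :
    2 * supConvolution N B u z - supConvolution N B u (z + h) - supConvolution N B u (z - h) ≤
      2 * N * ‖h‖ ^ 2 := by
  suffices supConvolution N B u z ≤
      (supConvolution N B u (z + h) + supConvolution N B u (z - h) + 2 * N * ‖h‖ ^ 2) / 2 by
    linarith
  refine supConvolution_le hB fun k hk => ?_
  have h1 := le_supConvolution hN hu hk (z + h)
  have h2 := le_supConvolution hN hu hk (z - h)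
  have e1 : z + h - k = (z - k) + h := by abel
  have e2 : z - h - k = (z - k) - h := by abel
  rw [e1, norm_add_sq_real] at h1
  rw [e2, norm_sub_sq_real] at h2
  linarith

end SupConvolution

set_option maxHeartbeats 800000 in
/-- Localization of the maximum points in the doubling of variables. -/
lemma exists_localized_doubling {E : Type*} [NormedAddCommGroup E] [InnerProductSpace ℝ E]
    [FiniteDimensional ℝ E] {u v : E → ℝ} {y₀ l : E} {ρ δ : ℝ} (hρ : 0 < ρ) (hδ : 0 < δ)
    (hu : ContinuousOn u (Metric.closedBall y₀ ρ)) (hv : ContinuousOn v (Metric.closedBall y₀ ρ))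
    (hmax : ∀ x ∈ Metric.closedBall y₀ ρ,
      u x + v x ≤ u y₀ + v y₀ + inner ℝ l (x - y₀) - δ * ‖x - y₀‖ ^ 2) :
    ∃ N > 0, ∃ r > 0, ∀ p ∈ Metric.ball l r, ∃ x ∈ Metric.ball y₀ ρ, ∃ y ∈ Metric.ball y₀ ρ,
      ∃ z : E, ∀ x' ∈ Metric.closedBall y₀ ρ, ∀ y' ∈ Metric.closedBall y₀ ρ, ∀ z' : E,
        u x' - N * ‖z' - x'‖ ^ 2 + (v y' - N * ‖z' - y'‖ ^ 2) + δ / 2 * ‖z' - y₀‖ ^ 2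
          - inner ℝ p (z' - y₀) ≤
        u x - N * ‖z - x‖ ^ 2 + (v y - N * ‖z - y‖ ^ 2) + δ / 2 * ‖z - y₀‖ ^ 2
          - inner ℝ p (z - y₀) := by
  set B := Metric.closedBall y₀ ρ with hBdef
  have hBc : IsCompact B := isCompact_closedBall y₀ ρ
  have hy₀ : y₀ ∈ B := Metric.mem_closedBall_self hρ.le
  have hBn : ∀ k ∈ B, ‖k - y₀‖ ≤ ρ := fun k hk => mem_closedBall_iff_norm.1 hk
  obtain ⟨mu, hmu⟩ := hBc.bddAbove_image hu
  obtain ⟨mv, hmv⟩ := hBc.bddAbove_image hv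
  have hmu' : ∀ x ∈ B, u x ≤ mu := fun x hx => hmu (Set.mem_image_of_mem u hx)
  have hmv' : ∀ x ∈ B, v x ≤ mv := fun x hx => hmv (Set.mem_image_of_mem v hx)
  set κ := δ * ρ ^ 2 / 100 with hκ
  have hκpos : 0 < κ := by positivity
  obtain ⟨τ, hτ, hunif⟩ := Metric.uniformContinuousOn_iff.1
    (hBc.uniformContinuousOn_of_continuous hv) κ hκpos
  set L := ‖l‖ with hL
  have hLnn : 0 ≤ L := norm_nonneg l
  -- the scale at which the three maximizing variables coincide
  obtain ⟨σ, hσ, hσ1, hσ2, hσ3⟩ : ∃ σ > 0, σ < ρ / 100 ∧ 2 * σ < τ ∧ L * σ < κ := by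
    refine ⟨min (min (ρ / 200) (τ / 4)) (κ / (2 * (L + 1))), by positivity, ?_, ?_, ?_⟩
    · exact ((min_le_left _ _).trans (min_le_left _ _)).trans_lt (by linarith)
    · have := (min_le_left (min (ρ / 200) (τ / 4)) (κ / (2 * (L + 1)))).trans (min_le_right _ _)
      linarith
    · have h1 := min_le_right (min (ρ / 200) (τ / 4)) (κ / (2 * (L + 1)))
      have h2 : L * (κ / (2 * (L + 1))) < κ := by
        rw [mul_div_assoc', div_lt_iff₀ (by positivity)]; nlinarith
      exact (mul_le_mul_of_nonneg_left h1 hLnn).trans_lt h2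
  set r := κ / (2 * ρ) with hr
  have hrpos : 0 < r := by positivity
  set c := u y₀ + v y₀ with hc
  -- `N` forces points with a value at least `c` to satisfy `‖z - x‖ ≤ σ`
  obtain ⟨N, hN, hNδ, hNσ⟩ : ∃ N > 0, 0 ≤ N - 2 * δ - (L + r) ∧
      mu + mv - c + 2 * δ * ρ ^ 2 + (L + r) * (ρ + 1) < (N - 2 * δ - (L + r)) * σ ^ 2 := by
    set K := mu + mv - c + 2 * δ * ρ ^ 2 + (L + r) * (ρ + 1) with hK
    refine ⟨2 * δ + (L + r) + (|K| + 1) / σ ^ 2, by positivity, ?_, ?_⟩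
    · have : 0 ≤ (|K| + 1) / σ ^ 2 := by positivity
      linarith
    · have : (2 * δ + (L + r) + (|K| + 1) / σ ^ 2 - 2 * δ - (L + r)) * σ ^ 2 = |K| + 1 := by
        field_simp; ring
      rw [this]; linarith [le_abs_self K]
  refine ⟨N, hN, r, hrpos, fun p hp => ?_⟩
  have hpl : ‖p - l‖ < r := mem_ball_iff_norm.1 hp
  have hpn : ‖p‖ ≤ L + r := by
    have := norm_add_le l (p - l)
    rw [add_sub_cancel] at this
    linarith
  set Ψ : E × E × E → ℝ := fun q => u q.1 - N * ‖q.2.2 - q.1‖ ^ 2 +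
    (v q.2.1 - N * ‖q.2.2 - q.2.1‖ ^ 2) + δ / 2 * ‖q.2.2 - y₀‖ ^ 2
    - inner ℝ p (q.2.2 - y₀) with hΨ
  have hclose : ∀ x ∈ B, ∀ y ∈ B, ∀ z, c ≤ Ψ (x, y, z) → ‖z - x‖ ≤ σ ∧ ‖z - y‖ ≤ σ := by
    intro x hx y hy z hz
    have aux : ∀ k ∈ B, mu + mv - c - N * ‖z - k‖ ^ 2 + δ / 2 * ‖z - y₀‖ ^ 2
        - inner ℝ p (z - y₀) ≥ 0 → ‖z - k‖ ≤ σ := by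
      intro k hk h
      by_contra! hlt
      have hk' : ‖k - y₀‖ ≤ ρ := hBn k hk
      have h1 : ‖z - y₀‖ ≤ ‖z - k‖ + ρ := by
        have := norm_add_le (z - k) (k - y₀)
        rw [sub_add_sub_cancel] at this
        linarith
      have h2 : -inner ℝ p (z - y₀) ≤ (L + r) * (‖z - k‖ + ρ) := by
        have h3 := (abs_le.1 (abs_real_inner_le_norm p (z - y₀))).1
        have h4 : ‖p‖ * ‖z - y₀‖ ≤ (L + r) * (‖z - k‖ + ρ) := by gcongr
        linarith
      set s := ‖z - k‖
      have h5 : ‖z - y₀‖ ^ 2 ≤ 2 * s ^ 2 + 2 * ρ ^ 2 := by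
        have : ‖z - y₀‖ ^ 2 ≤ (s + ρ) ^ 2 := by gcongr
        nlinarith [sq_nonneg (s - ρ)]
      have h6 : s ≤ s ^ 2 + 1 := by nlinarith [sq_nonneg (s - 1)]
      have h7 : (N - 2 * δ - (L + r)) * σ ^ 2 ≤ (N - 2 * δ - (L + r)) * s ^ 2 := by gcongr
      have h8 : (L + r) * s ≤ (L + r) * (s ^ 2 + 1) := by gcongr
      have h9 : δ / 2 * ‖z - y₀‖ ^ 2 ≤ δ / 2 * (2 * s ^ 2 + 2 * ρ ^ 2) := by gcongr
      have h10 : 0 ≤ δ * s ^ 2 := by positivity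
      have h11 : 0 ≤ δ * ρ ^ 2 := by positivity
      nlinarith
    have h1 := hmu' x hx
    have h2 := hmv' y hy
    have h3 : 0 ≤ N * ‖z - x‖ ^ 2 := by positivity
    have h4 : 0 ≤ N * ‖z - y‖ ^ 2 := by positivity
    simp only [hΨ] at hz
    exact ⟨aux x hx (by linarith), aux y hy (by linarith)⟩
  have hcont : ContinuousOn Ψ (B ×ˢ B ×ˢ Metric.closedBall y₀ (2 * ρ)) := by
    have c1 : ContinuousOn (fun q : E × E × E => u q.1)
        (B ×ˢ B ×ˢ Metric.closedBall y₀ (2 * ρ)) :=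
      hu.comp continuous_fst.continuousOn fun q hq => hq.1
    have c2 : ContinuousOn (fun q : E × E × E => v q.2.1)
        (B ×ˢ B ×ˢ Metric.closedBall y₀ (2 * ρ)) :=
      hv.comp (by fun_prop) fun q hq => hq.2.1
    have c3 : Continuous fun q : E × E × E => N * ‖q.2.2 - q.1‖ ^ 2 := by fun_prop
    have c4 : Continuous fun q : E × E × E => N * ‖q.2.2 - q.2.1‖ ^ 2 := by fun_prop
    have c5 : Continuous fun q : E × E × E => δ / 2 * ‖q.2.2 - y₀‖ ^ 2 := by fun_prop
    have c6 : Continuous fun q : E × E × E => (inner ℝ p (q.2.2 - y₀) : ℝ) := by fun_prop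
    exact (((c1.sub c3.continuousOn).add (c2.sub c4.continuousOn)).add c5.continuousOn).sub
      c6.continuousOn
  obtain ⟨⟨x, y, z⟩, ⟨hx, hy, -⟩, hq⟩ :=
    (hBc.prod (hBc.prod (isCompact_closedBall y₀ (2 * ρ)))).exists_isMaxOn
      ⟨(y₀, y₀, y₀), hy₀, hy₀, Metric.mem_closedBall_self (by positivity)⟩ hcont
  have hcval : Ψ (y₀, y₀, y₀) = c := by simp [hΨ, hc]
  have hge : c ≤ Ψ (x, y, z) := by
    rw [← hcval]
    exact hq ⟨hy₀, hy₀, Metric.mem_closedBall_self (by positivity)⟩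
  obtain ⟨hzx, hzy⟩ := hclose x hx y hy z hge
  have hxρ : ‖x - y₀‖ ≤ ρ := hBn x hx
  have hxy : ‖x - y‖ ≤ 2 * σ := by
    have := norm_sub_le (z - y) (z - x)
    rw [sub_sub_sub_cancel_left] at this
    linarith
  have hxhalf : ‖x - y₀‖ < ρ / 2 := by
    by_contra! hge'
    have h1 := hmax x hx
    have h2 : v y ≤ v x + κ := by
      have := hunif x hx y hy (by rw [dist_eq_norm]; linarith)
      rw [Real.dist_eq] at this
      linarith [(abs_lt.1 this).1]
    have h3 : inner ℝ l (x - y₀) - inner ℝ p (z - y₀) ≤ L * σ + r * (ρ + σ) := by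
      have e : inner ℝ l (x - y₀) - inner ℝ p (z - y₀) =
          -inner ℝ l (z - x) - inner ℝ (p - l) (z - y₀) := by
        simp only [inner_sub_left, inner_sub_right]; ring
      have h4 := (abs_le.1 (abs_real_inner_le_norm l (z - x))).1
      have h5 := (abs_le.1 (abs_real_inner_le_norm (p - l) (z - y₀))).1
      have h6 : ‖z - y₀‖ ≤ ρ + σ := by
        have := norm_add_le (z - x) (x - y₀)
        rw [sub_add_sub_cancel] at this
        linarith
      have h7 : ‖l‖ * ‖z - x‖ ≤ L * σ := by gcongr
      have h8 : ‖p - l‖ * ‖z - y₀‖ ≤ r * (ρ + σ) := by gcongr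
      rw [e]; linarith
    have h6 : ‖z - y₀‖ ≤ ‖x - y₀‖ + σ := by
      have := norm_add_le (z - x) (x - y₀)
      rw [sub_add_sub_cancel] at this
      linarith
    set s := ‖x - y₀‖
    have h9 : δ / 2 * ‖z - y₀‖ ^ 2 ≤ δ / 2 * (s + σ) ^ 2 := by gcongr
    have h10 : 0 ≤ N * ‖z - x‖ ^ 2 := by positivity
    have h11 : 0 ≤ N * ‖z - y‖ ^ 2 := by positivity
    simp only [hΨ] at hge
    have h12 : r * (ρ + σ) ≤ r * (2 * ρ) := by
      gcongr; linarith
    have h13 : r * (2 * ρ) = κ := by rw [hr]; field_simp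
    have h14 : c ≤ c - δ * s ^ 2 + κ + (κ + κ) + δ / 2 * (s + σ) ^ 2 := by linarith
    have h15 : (s + σ) ^ 2 ≤ s ^ 2 + ρ ^ 2 / 20 := by nlinarith
    have h16 : δ / 2 * (s + σ) ^ 2 ≤ δ / 2 * (s ^ 2 + ρ ^ 2 / 20) := by gcongr
    have h17 : δ / 2 * (ρ / 2) ^ 2 ≤ δ / 2 * s ^ 2 := by gcongr
    have h18 : 0 < δ * ρ ^ 2 := by positivity
    nlinarith
  refine ⟨x, mem_ball_iff_norm.2 (by linarith), y, ?_, z, ?_⟩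
  · rw [Metric.mem_ball, dist_eq_norm]
    have := norm_sub_le (x - y₀) (x - y)
    rw [sub_sub_sub_cancel_left] at this
    linarith
  · intro x' hx' y' hy' z'
    change Ψ (x', y', z') ≤ Ψ (x, y, z)
    rcases lt_or_ge (Ψ (x', y', z')) c with hlt | hge'
    · exact hlt.le.trans hge
    · have h1 := (hclose x' hx' y' hy' z' hge').1
      refine hq ⟨hx', hy', ?_⟩
      rw [Metric.mem_closedBall, dist_eq_norm]
      have h2 : ‖x' - y₀‖ ≤ ρ := hBn x' hx'
      have := norm_add_le (z' - x') (x' - y₀)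
      rw [sub_add_sub_cancel] at this
      linarith

lemma ConvexOn.two_mul_le_add_sub {E : Type*} [NormedAddCommGroup E] [NormedSpace ℝ E]
    {w : E → ℝ} (hw : ConvexOn ℝ Set.univ w) (z h : E) : 2 * w z ≤ w (z + h) + w (z - h) := by
  have := hw.2 (Set.mem_univ (z + h)) (Set.mem_univ (z - h)) (by norm_num : (0 : ℝ) ≤ 1 / 2)
    (by norm_num : (0 : ℝ) ≤ 1 / 2) (by norm_num)
  have e : (1 / 2 : ℝ) • (z + h) + (1 / 2 : ℝ) • (z - h) = z := by module
  rw [e] at this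
  simp only [smul_eq_mul] at this
  linarith

lemma convexOn_affine {E : Type*} [NormedAddCommGroup E] [InnerProductSpace ℝ E] (c : ℝ)
    (p z : E) : ConvexOn ℝ Set.univ fun z' => c - inner ℝ p (z' - z) := by
  refine ⟨convex_univ, fun x _ y _ a b ha hb hab => le_of_eq ?_⟩
  simp only [inner_sub_right, inner_add_right, inner_smul_right, smul_eq_mul]
  obtain rfl : b = 1 - a := by linarith
  ring

lemma eq_neg_of_hasFDerivAt_of_le {E : Type*} [NormedAddCommGroup E] [InnerProductSpace ℝ E]
    {w : E → ℝ} {q p z : E} (hw : HasFDerivAt w (innerSL ℝ q) z)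
    (h : ∀ z', w z - inner ℝ p (z' - z) ≤ w z') : q = -p := by
  have h1 : HasFDerivAt (fun z' => w z' + inner ℝ p (z' - z)) (innerSL ℝ q + innerSL ℝ p) z :=
    hw.add ((innerSL ℝ p).hasFDerivAt.comp z ((hasFDerivAt_id z).sub_const z))
  have h2 : IsLocalMin (fun z' => w z' + inner ℝ p (z' - z)) z :=
    Eventually.of_forall fun z' => by
      have := h z'
      simp only [sub_self, inner_zero_right, add_zero]
      linarith
  have h3 := h2.hasFDerivAt_eq_zero h1
  rw [← map_add] at h3
  have h4 : ‖q + p‖ = 0 := by rw [← innerSL_apply_norm (𝕜 := ℝ), h3, norm_zero]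
  exact eq_neg_of_add_eq_zero_left (norm_eq_zero.1 h4)

/-- A second order maximum principle for sums of continuous functions: near a strict maximum
point of `u + v`, there are points with one-sided second order expansions of `u` and `v` whose
second order parts add up to a negative definite form. -/
lemma exists_second_order_contact {E : Type*} [NormedAddCommGroup E] [InnerProductSpace ℝ E]
    [FiniteDimensional ℝ E] {u v : E → ℝ} {y₀ l : E} {ρ δ η : ℝ} (hρ : 0 < ρ) (hδ : 0 < δ)
    (hη : 0 < η)
    (hu : ContinuousOn u (Metric.closedBall y₀ ρ)) (hv : ContinuousOn v (Metric.closedBall y₀ ρ))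
    (hmax : ∀ x ∈ Metric.closedBall y₀ ρ,
      u x + v x ≤ u y₀ + v y₀ + inner ℝ l (x - y₀) - δ * ‖x - y₀‖ ^ 2) :
    ∃ x ∈ Metric.ball y₀ ρ, ∃ y ∈ Metric.ball y₀ ρ, ∃ (a b : E) (A : E →L[ℝ] E),
      (∀ h k, inner ℝ (A h) k = inner ℝ h (A k)) ∧
      (∀ᶠ h in 𝓝 (0 : E), u (x + h) ≤ u x + inner ℝ a h + inner ℝ (A h) h / 2 + η * ‖h‖ ^ 2) ∧
      ∀ᶠ h in 𝓝 (0 : E),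
        v (y + h) ≤ v y + inner ℝ b h - inner ℝ (A h) h / 2 - δ / 2 * ‖h‖ ^ 2 + η * ‖h‖ ^ 2 := by
  obtain ⟨N, hN, r, hr, hdouble⟩ := exists_localized_doubling hρ hδ hu hv hmax
  set B := Metric.closedBall y₀ ρ with hBdef
  have hBc : IsCompact B := isCompact_closedBall y₀ ρ
  have hB : B.Nonempty := ⟨y₀, Metric.mem_closedBall_self hρ.le⟩
  obtain ⟨mu, hmu⟩ := hBc.bddAbove_image hu
  obtain ⟨mv, hmv⟩ := hBc.bddAbove_image hv
  have hmu' : ∀ x ∈ B, u x ≤ mu := fun x hx => hmu (Set.mem_image_of_mem u hx)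
  have hmv' : ∀ x ∈ B, v x ≤ mv := fun x hx => hmv (Set.mem_image_of_mem v hx)
  set f := supConvolution N B u with hf
  set g := supConvolution N B v with hg
  have hfle : ∀ x ∈ B, ∀ z, u x - N * ‖z - x‖ ^ 2 ≤ f z :=
    fun x hx z => le_supConvolution hN.le hmu' hx z
  have hgle : ∀ x ∈ B, ∀ z, v x - N * ‖z - x‖ ^ 2 ≤ g z :=
    fun x hx z => le_supConvolution hN.le hmv' hx z
  set g₁ : E → ℝ := fun z => -(f z + g z + δ / 2 * ‖z - y₀‖ ^ 2) with hg₁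
  set Contact : E → E → E → E → Prop := fun p x y z =>
    f z = u x - N * ‖z - x‖ ^ 2 ∧ g z = v y - N * ‖z - y‖ ^ 2 ∧
      ∀ z', g₁ z - inner ℝ p (z' - z) ≤ g₁ z' with hContact
  have hcontact : ∀ p ∈ Metric.ball l r, ∃ x ∈ Metric.ball y₀ ρ, ∃ y ∈ Metric.ball y₀ ρ, ∃ z,
      Contact p x y z := by
    intro p hp
    obtain ⟨x, hx, y, hy, z, hxyz⟩ := hdouble p hp
    have hxB := Metric.ball_subset_closedBall hx
    have hyB := Metric.ball_subset_closedBall hy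
    have h1 : f z = u x - N * ‖z - x‖ ^ 2 := by
      refine le_antisymm (supConvolution_le hB fun x' hx' => ?_) (hfle x hxB z)
      have := hxyz x' hx' y hyB z
      linarith
    have h2 : g z = v y - N * ‖z - y‖ ^ 2 := by
      refine le_antisymm (supConvolution_le hB fun y' hy' => ?_) (hgle y hyB z)
      have := hxyz x hxB y' hy' z
      linarith
    refine ⟨x, hx, y, hy, z, h1, h2, fun z' => ?_⟩
    set T := f z + g z + δ / 2 * ‖z - y₀‖ ^ 2 - inner ℝ p (z - y₀) with hT
    have h3 : f z' ≤ T - g z' - δ / 2 * ‖z' - y₀‖ ^ 2 + inner ℝ p (z' - y₀) := by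
      refine supConvolution_le hB fun x' hx' => ?_
      rw [← sub_nonneg]
      suffices g z' ≤ T - (u x' - N * ‖z' - x'‖ ^ 2) - δ / 2 * ‖z' - y₀‖ ^ 2
        + inner ℝ p (z' - y₀) by linarith
      refine supConvolution_le hB fun y' hy' => ?_
      have := hxyz x' hx' y' hy' z'
      rw [hT, h1, h2]
      linarith
    have e : inner ℝ p (z' - z) = inner ℝ p (z' - y₀) - inner ℝ p (z - y₀) := by
      rw [← inner_sub_right, sub_sub_sub_cancel_right]
    simp only [hg₁]
    rw [e]
    linarith
  have hsq : ∀ z h : E, ‖z + h - y₀‖ ^ 2 + ‖z - h - y₀‖ ^ 2 - 2 * ‖z - y₀‖ ^ 2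
      = 2 * ‖h‖ ^ 2 := by
    intro z h
    have e1 : z + h - y₀ = (z - y₀) + h := by abel
    have e2 : z - h - y₀ = (z - y₀) - h := by abel
    rw [e1, e2, norm_add_sq_real (z - y₀), norm_sub_sq_real (z - y₀)]; ring
  have hsq0 : ∀ z h : E, ‖z + h‖ ^ 2 + ‖z - h‖ ^ 2 - 2 * ‖z‖ ^ 2 = 2 * ‖h‖ ^ 2 := by
    intro z h
    rw [norm_add_sq_real, norm_sub_sq_real]; ring
  have hfs := fun z h => supConvolution_add_sub hN.le hB hmu' z h
  have hgs := fun z h => supConvolution_add_sub hN.le hB hmv' z h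
  have hg₁s : ∀ z h, g₁ (z + h) + g₁ (z - h) - 2 * g₁ z ≤ 4 * N * ‖h‖ ^ 2 := fun z h => by
    have h1 := hfs z h
    have h2 := hgs z h
    have h3 := hsq z h
    have h4 : 0 ≤ δ * ‖h‖ ^ 2 := by positivity
    simp only [hg₁]
    linear_combination h1 + h2 + h4 - δ / 2 * h3
  obtain ⟨-, -, -, -, z₀, -, -, hz₀⟩ := hcontact l (Metric.mem_ball_self hr)
  obtain ⟨w₁, hw₁c, hw₁le, hw₁max, hw₁s⟩ :=
    exists_convex_envelope (convexOn_affine (g₁ z₀) l z₀) hz₀ hg₁s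
  obtain ⟨P₁, hP₁lip, hP₁, -⟩ := hw₁c.exists_lipschitz_gradient (by positivity) hw₁s
  have hw₁contact : ∀ {p x y z}, Contact p x y z →
      w₁ z = g₁ z ∧ ∀ z', g₁ z - inner ℝ p (z' - z) ≤ w₁ z' := by
    rintro p x y z ⟨-, -, h⟩
    have h1 := hw₁max _ (convexOn_affine (g₁ z) p z) h
    exact ⟨le_antisymm (hw₁le z) (by simpa using h1 z), h1⟩
  set g₂ : E → ℝ := fun z => -w₁ z - g z - δ / 2 * ‖z - y₀‖ ^ 2 + N * ‖z‖ ^ 2 with hg₂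
  have hfg₂ : ∀ z, f z + N * ‖z‖ ^ 2 ≤ g₂ z := fun z => by
    have := hw₁le z
    simp only [hg₁] at this
    simp only [hg₂]
    linarith
  have hg₂s : ∀ z h, g₂ (z + h) + g₂ (z - h) - 2 * g₂ z ≤ 4 * N * ‖h‖ ^ 2 := fun z h => by
    have h1 := hw₁c.two_mul_le_add_sub z h
    have h2 := hgs z h
    have h3 := hsq z h
    have h4 : 0 ≤ δ * ‖h‖ ^ 2 := by positivity
    have h5 := hsq0 z h
    simp only [hg₂]
    linear_combination h1 + h2 + h4 - δ / 2 * h3 + N * h5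
  obtain ⟨w₂, hw₂c, hw₂le, hw₂max, hw₂s⟩ :=
    exists_convex_envelope (convexOn_supConvolution_add hN.le hB hmu') hfg₂ hg₂s
  have hfw₂ : ∀ z, f z + N * ‖z‖ ^ 2 ≤ w₂ z :=
    hw₂max _ (convexOn_supConvolution_add hN.le hB hmu') hfg₂
  obtain ⟨P₂, hP₂lip, hP₂, -⟩ := hw₂c.exists_lipschitz_gradient (by positivity) hw₂s
  obtain ⟨z, ⟨p, x, hx, y, hy, hc⟩, hdiff⟩ := hP₁lip.exists_mem_differentiableAt hP₂lip
    (S := {z | ∃ p, ∃ x ∈ Metric.ball y₀ ρ, ∃ y ∈ Metric.ball y₀ ρ, Contact p x y z})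
    (c := -l) hr fun q hq => by
      have hq' : -q ∈ Metric.ball l r := by
        rw [mem_ball_iff_norm] at hq ⊢
        have e : -q - l = -(q - -l) := by abel
        rwa [e, norm_neg]
      obtain ⟨x, hx, y, hy, z, hc⟩ := hcontact (-q) hq'
      refine ⟨z, ⟨-q, x, hx, y, hy, hc⟩, ?_⟩
      obtain ⟨h1, h2⟩ := hw₁contact hc
      rw [eq_neg_of_hasFDerivAt_of_le (p := -q) (hP₁ z) (by rw [h1]; exact h2), neg_neg]
  obtain ⟨hw₁z, hw₁aff⟩ := hw₁contact hc
  obtain ⟨hfz, hgz, -⟩ := hc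
  obtain ⟨hsymm, hexp⟩ := second_order_expansion hP₂ hdiff.hasFDerivAt
  set A := fderiv ℝ P₂ z with hA
  have hw₂z : w₂ z = f z + N * ‖z‖ ^ 2 := by
    refine le_antisymm ((hw₂le z).trans ?_) (hfw₂ z)
    simp only [hg₂, hw₁z, hg₁]
    linarith
  have hAN : ∀ h, inner ℝ ((A - (2 * N) • ContinuousLinearMap.id ℝ E) h) h =
      inner ℝ (A h) h - 2 * N * ‖h‖ ^ 2 := fun h => by
    simp [inner_sub_left, inner_smul_left]
  have hnear : ∀ x ∈ Metric.ball y₀ ρ, ∀ᶠ h in 𝓝 (0 : E), x + h ∈ B := fun x hx => by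
    have : Tendsto (fun h => x + h) (𝓝 0) (𝓝 x) := by
      have := (continuous_const_add x).tendsto (0 : E)
      rwa [add_zero] at this
    exact this.eventually (Metric.closedBall_mem_nhds_of_mem hx)
  refine ⟨x, hx, y, hy, P₂ z - (2 * N) • z, p - δ • (z - y₀) + (2 * N) • z - P₂ z,
    A - (2 * N) • ContinuousLinearMap.id ℝ E, fun h k => ?_, ?_, ?_⟩
  · simp [inner_sub_left, inner_sub_right, inner_smul_left, inner_smul_right, hsymm h k]
  · filter_upwards [hexp η hη, hnear x hx] with h h1 h2
    have h3 := hfle _ h2 (z + h)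
    have h4 := hfw₂ (z + h)
    rw [add_sub_add_right_eq_sub] at h3
    rw [norm_add_sq_real] at h4
    rw [hAN, inner_sub_left, inner_smul_left]
    simp only [conj_trivial]
    linarith [(abs_le.1 h1).2]
  · filter_upwards [hexp η hη, hnear y hy] with h h1 h2
    have h3 := hgle _ h2 (z + h)
    have h4 := hw₂le (z + h)
    have h5 := hw₁aff (z + h)
    have e : z + h - y₀ = (z - y₀) + h := by abel
    simp only [hg₂] at h4
    rw [add_sub_add_right_eq_sub] at h3
    rw [norm_add_sq_real, e, norm_add_sq_real] at h4
    rw [add_sub_cancel_left] at h5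
    simp only [hg₁] at h5
    rw [hAN, inner_sub_left, inner_add_left, inner_sub_left, inner_smul_left, inner_smul_left]
    simp only [conj_trivial]
    linarith [(abs_le.1 h1).1]

/-- The quadratic polynomial with value `c`, gradient `a` and second order part `A` at `x`. -/
def quadraticAt (c : ℝ) (a : EucSp n) (A : EucSp n →L[ℝ] EucSp n) (x y : EucSp n) : ℝ :=
  c + inner ℝ a (y - x) + inner ℝ (A (y - x)) (y - x) / 2

lemma contDiff_quadraticAt (c : ℝ) (a : EucSp n) (A : EucSp n →L[ℝ] EucSp n) (x : EucSp n) :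
    ContDiff ℝ 2 (quadraticAt c a A x) := by
  have h1 : ContDiff ℝ 2 fun y : EucSp n => y - x := contDiff_id.sub contDiff_const
  exact (contDiff_const.add (contDiff_const.inner ℝ h1)).add
    (((A.contDiff.comp h1).inner ℝ h1).div_const 2)

lemma hessMatrix_quadraticAt (c : ℝ) (a : EucSp n) {A : EucSp n →L[ℝ] EucSp n}
    (hA : ∀ h k, inner ℝ (A h) k = inner ℝ h (A k)) (x y : EucSp n) :
    hessMatrix (quadraticAt c a A x) y = Matrix.of fun i j =>
      (inner ℝ (A (EuclideanSpace.single i 1)) (EuclideanSpace.single j 1) : ℝ) := by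
  have hd : ∀ z, HasFDerivAt (quadraticAt c a A x) (innerSL ℝ (a + A (z - x))) z := fun z => by
    have h0 : HasFDerivAt (fun y : EucSp n => y - x) (ContinuousLinearMap.id ℝ _) z :=
      (hasFDerivAt_id z).sub_const x
    have h1 : HasFDerivAt (fun y => inner ℝ a (y - x)) (innerSL ℝ a) z :=
      (innerSL ℝ a).hasFDerivAt.comp z h0
    have h2 := ((A.hasFDerivAt (x := z - x)).comp z h0).inner ℝ h0
    have h3 := (h1.const_add c).add (h2.mul_const (1 / 2))
    refine (h3.congr_fderiv ?_).congr_of_eventuallyEq (Eventually.of_forall fun k => ?_)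
    · ext k
      have hk : inner ℝ k (A z - A x) = inner ℝ (A z) k - inner ℝ (A x) k := by
        rw [real_inner_comm, inner_sub_left]
      simp [fderivInnerCLM_apply, hA k, inner_sub_left, hk]
      ring
    · simp [quadraticAt]
      ring
  have hfd : fderiv ℝ (quadraticAt c a A x) = fun z => innerSL ℝ (a + A (z - x)) :=
    funext fun z => (hd z).fderiv
  have h2 : HasFDerivAt (fun z => innerSL ℝ (a + A (z - x))) ((innerSL ℝ).comp A) y :=
    (innerSL ℝ).hasFDerivAt.comp y
      ((A.hasFDerivAt.comp y ((hasFDerivAt_id y).sub_const x)).const_add a)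
  ext i j
  simp only [hessMatrix, Matrix.of_apply, iteratedFDeriv_two_apply, hfd]
  rw [h2.fderiv]
  rfl

lemma eventually_isTestAt_quadraticAt {X : Set (EucSp n)} {u : EucSp n → ℝ} {x a : EucSp n}
    {A : EucSp n →L[ℝ] EucSp n}
    (h : ∀ᶠ k in 𝓝 (0 : EucSp n), u (x + k) ≤ u x + inner ℝ a k + inner ℝ (A k) k / 2) :
    IsTestAt X (fun y => (u y : EReal)) (quadraticAt (u x) a A x) x := by
  refine ⟨(contDiff_quadraticAt _ _ _ _).contDiffAt, ?_, by simp [quadraticAt]⟩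
  have ht : Tendsto (fun y => y - x) (𝓝 x) (𝓝 0) := by
    have := (continuous_sub_right x).tendsto x
    rwa [sub_self] at this
  refine ((ht.eventually h).filter_mono nhdsWithin_le_nhds).mono fun y hy => ?_
  rw [add_sub_cancel] at hy
  exact EReal.coe_le_coe_iff.2 hy

lemma ConeSubequation.mem_interior_of_eq_add (F : ConeSubequation n) {S T : SymMat n} {t : ℝ}
    (ht : 0 < t) (hS : S ∈ F.carrier) (hT : (T : Matrix (Fin n) (Fin n) ℝ) = S + t • 1) :
    T ∈ interior F.carrier := by
  rw [mem_interior_iff_mem_nhds]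
  set ε := t / (n + 1) with hε
  have hεpos : 0 < ε := by positivity
  have hnear : ∀ᶠ R : SymMat n in 𝓝 T, ∀ i j,
      |(R : Matrix (Fin n) (Fin n) ℝ) i j - (T : Matrix (Fin n) (Fin n) ℝ) i j| < ε := by
    rw [eventually_all]; intro i
    rw [eventually_all]; intro j
    have hc : Continuous fun R : SymMat n => (R : Matrix (Fin n) (Fin n) ℝ) i j :=
      continuous_subtype_val.matrix_elem i j
    exact (Metric.tendsto_nhds.1 (hc.tendsto T)) ε hεpos
  filter_upwards [hnear] with R hR
  have hRS : R = S + (R - S) := by abel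
  rw [hRS]
  refine F.f1 S hS _ (Matrix.PosSemidef.of_dotProduct_mulVec_nonneg ?_ fun v => ?_)
  · exact (R - S).2
  have hterm : ∀ i j, -(ε / 2 * (v i ^ 2 + v j ^ 2)) + (if i = j then t * v i ^ 2 else 0) ≤
      v i * (((R - S : SymMat n) : Matrix (Fin n) (Fin n) ℝ) i j * v j) := by
    intro i j
    have h1 : ((R - S : SymMat n) : Matrix (Fin n) (Fin n) ℝ) i j =
        ((R : Matrix (Fin n) (Fin n) ℝ) i j - (T : Matrix (Fin n) (Fin n) ℝ) i j)
          + if i = j then t else 0 := by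
      rw [hT]
      simp only [AddSubgroupClass.coe_sub, Matrix.sub_apply, Matrix.add_apply, Matrix.smul_apply,
        Matrix.one_apply, smul_eq_mul, mul_ite, mul_one, mul_zero]
      ring
    set d := (R : Matrix (Fin n) (Fin n) ℝ) i j - (T : Matrix (Fin n) (Fin n) ℝ) i j with hd
    have h2 : |d| ≤ ε := (hR i j).le
    have h3 : -(ε / 2 * (v i ^ 2 + v j ^ 2)) ≤ v i * (d * v j) := by
      have h4 : |v i * (d * v j)| ≤ ε * (|v i| * |v j|) := by
        rw [abs_mul, abs_mul]
        calc |v i| * (|d| * |v j|) = |d| * (|v i| * |v j|) := by ring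
          _ ≤ _ := by gcongr
      have h5 : |v i| * |v j| ≤ (v i ^ 2 + v j ^ 2) / 2 := by
        nlinarith [sq_nonneg (|v i| - |v j|), sq_abs (v i), sq_abs (v j)]
      have h6 := (abs_le.1 h4).1
      nlinarith [mul_le_mul_of_nonneg_left h5 hεpos.le]
    rw [h1]
    split_ifs with hij
    · subst hij; nlinarith
    · linarith
  have hsum := Finset.sum_le_sum fun i (_ : i ∈ Finset.univ) =>
    Finset.sum_le_sum fun j (_ : j ∈ Finset.univ) => hterm i j
  have hval : ∑ i, ∑ j, (-(ε / 2 * (v i ^ 2 + v j ^ 2)) + if i = j then t * v i ^ 2 else 0) =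
      (t - n * ε) * ∑ i, v i ^ 2 := by
    simp only [Finset.sum_add_distrib, Finset.sum_neg_distrib, ← Finset.mul_sum,
      Finset.sum_const, Finset.card_univ, Fintype.card_fin, Finset.sum_ite_eq, Finset.mem_univ,
      if_true, nsmul_eq_mul]
    ring
  have hnn : 0 ≤ (t - n * ε) * ∑ i, v i ^ 2 := by
    refine mul_nonneg ?_ (Finset.sum_nonneg fun i _ => sq_nonneg _)
    have : (n + 1) * ε = t := by rw [hε]; field_simp
    linarith
  simp only [dotProduct, Matrix.mulVec, Pi.star_apply, star_trivial, Finset.mul_sum]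
  linarith

/-- The comparison principle in infinitesimal form: if `u` is `F`-subharmonic and `v` is
subharmonic for the dual subequation, then `u + v + δ‖·‖²` has no local maximum. -/
lemma ConeSubequation.not_isLocalMax (F : ConeSubequation n) {X : Set (EucSp n)} (hX : IsOpen X)
    {u v : EucSp n → ℝ} (hu : ContinuousOn u X) (hv : ContinuousOn v X)
    (huF : ∀ x ∈ X, ∀ ψ : EucSp n → ℝ, IsTestAt X (fun y => (u y : EReal)) ψ x →
      hessMatrix ψ x ∈ Subtype.val '' F.carrier)
    (hvF : ∀ x ∈ X, ∀ ψ : EucSp n → ℝ, IsTestAt X (fun y => (v y : EReal)) ψ x →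
      hessMatrix ψ x ∈ Subtype.val '' dualSet F.carrier)
    {δ : ℝ} (hδ : 0 < δ) {y₀ : EucSp n} (hy₀ : y₀ ∈ X) :
    ¬ IsLocalMax (fun x => u x + v x + δ * ‖x‖ ^ 2) y₀ := by
  intro hmax
  obtain ⟨ρ, hρ, hball⟩ := Metric.nhds_basis_closedBall.mem_iff.1
    (inter_mem (hX.mem_nhds hy₀) hmax)
  have hBX : Metric.closedBall y₀ ρ ⊆ X := fun x hx => (hball hx).1
  obtain ⟨x, hx, y, hy, a, b, A, hA, hux, hvy⟩ := exists_second_order_contact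
    (l := (-(2 * δ)) • y₀) (η := δ / 8) hρ hδ (by positivity) (hu.mono hBX) (hv.mono hBX)
    fun x hx => by
      have h1 : u x + v x + δ * ‖x‖ ^ 2 ≤ u y₀ + v y₀ + δ * ‖y₀‖ ^ 2 := (hball hx).2
      have h2 : ‖x‖ ^ 2 = ‖y₀‖ ^ 2 + 2 * inner ℝ y₀ (x - y₀) + ‖x - y₀‖ ^ 2 := by
        rw [← norm_add_sq_real, add_sub_cancel]
      rw [inner_smul_left, conj_trivial]
      rw [h2] at h1
      linarith
  have hxX := hBX (Metric.ball_subset_closedBall hx)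
  have hyX := hBX (Metric.ball_subset_closedBall hy)
  set I := ContinuousLinearMap.id ℝ (EucSp n) with hI
  obtain ⟨S, hS, hSeq⟩ := huF x hxX _ (eventually_isTestAt_quadraticAt (a := a)
    (A := A + (δ / 4) • I) (hux.mono fun h hh => by
      simp only [add_apply, hI, smul_apply,
        ContinuousLinearMap.id_apply, inner_add_left, inner_smul_left, conj_trivial,
        real_inner_self_eq_norm_sq]
      linarith))
  obtain ⟨T, hT, hTeq⟩ := hvF y hyX _ (eventually_isTestAt_quadraticAt (a := b)
    (A := -A - (3 * δ / 4) • I) (hvy.mono fun h hh => by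
      simp only [sub_apply, neg_apply, hI,
        smul_apply, ContinuousLinearMap.id_apply, inner_sub_left,
        inner_neg_left, inner_smul_left, conj_trivial, real_inner_self_eq_norm_sq]
      linarith))
  rw [hessMatrix_quadraticAt _ _ fun h k => by
    simp [hI, inner_add_left, inner_add_right, inner_smul_left, inner_smul_right, hA h k]] at hSeq
  rw [hessMatrix_quadraticAt _ _ fun h k => by
    simp [hI, inner_sub_left, inner_sub_right, inner_smul_left, inner_smul_right, hA h k]] at hTeq
  refine hT (F.mem_interior_of_eq_add (t := δ / 2) (by positivity) hS ?_)
  rw [AddSubgroup.coe_neg, hSeq, hTeq]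
  ext i j
  have hij : (inner ℝ (EuclideanSpace.single i (1 : ℝ)) (EuclideanSpace.single j (1 : ℝ)) : ℝ) =
      (1 : Matrix (Fin n) (Fin n) ℝ) i j := by
    rw [EuclideanSpace.inner_single_left, Matrix.one_apply]
    simp
  simp only [Matrix.neg_apply, Matrix.of_apply, Matrix.add_apply, Matrix.smul_apply,
    sub_apply, neg_apply, hI,
    smul_apply, ContinuousLinearMap.id_apply, add_apply,
    inner_sub_left, inner_add_left, inner_neg_left, inner_smul_left, conj_trivial, hij,
    smul_eq_mul]
  ring

lemma isTestAt_inv_mul {X : Set (EucSp n)} {u ψ : EucSp n → ℝ} {c : ℝ} (hc : 0 < c) {x : EucSp n}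
    (h : IsTestAt X (fun y => ((c * u y : ℝ) : EReal)) ψ x) :
    IsTestAt X (fun y => (u y : EReal)) (fun y => c⁻¹ * ψ y) x := by
  obtain ⟨h1, h2, h3⟩ := h
  refine ⟨contDiffAt_const.mul h1, h2.mono fun y hy => ?_, ?_⟩
  · rw [EReal.coe_le_coe_iff] at hy ⊢
    change u y ≤ c⁻¹ * ψ y
    rwa [inv_mul_eq_div, le_div_iff₀' hc]
  · simp only [EReal.coe_eq_coe_iff] at h3 ⊢
    rw [← h3, inv_mul_cancel_left₀ hc.ne']

lemma hessMatrix_const_mul {ψ : EucSp n → ℝ} {x : EucSp n} (h : ContDiffAt ℝ 2 ψ x) (c : ℝ) :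
    hessMatrix (fun y => c * ψ y) x = c • hessMatrix ψ x := by
  ext i j
  have : iteratedFDeriv ℝ 2 (fun y => c * ψ y) x = c • iteratedFDeriv ℝ 2 ψ x :=
    iteratedFDeriv_const_smul_apply (a := c) (f := ψ) h
  simp [hessMatrix, this]

lemma ConeSubequation.hessMatrix_mem_of_isTestAt_const_mul (F : ConeSubequation n)
    {X : Set (EucSp n)} {u : EucSp n → ℝ}
    (hu : ∀ x ∈ X, ∀ ψ : EucSp n → ℝ, IsTestAt X (fun y => (u y : EReal)) ψ x →
      hessMatrix ψ x ∈ Subtype.val '' F.carrier)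
    {c : ℝ} (hc : 0 < c) {x : EucSp n} (hx : x ∈ X) {ψ : EucSp n → ℝ}
    (hψ : IsTestAt X (fun y => ((c * u y : ℝ) : EReal)) ψ x) :
    hessMatrix ψ x ∈ Subtype.val '' F.carrier := by
  obtain ⟨A, hA, hAeq⟩ := hu x hx _ (isTestAt_inv_mul hc hψ)
  refine ⟨c • A, F.f2 A hA c hc, ?_⟩
  rw [hessMatrix_const_mul hψ.1] at hAeq
  change c • (A : Matrix (Fin n) (Fin n) ℝ) = _
  rw [hAeq, smul_inv_smul₀ hc.ne']

namespace DPSingular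

variable {F : ConeSubequation n} {U : Set (EucSp n)} {x₀ : EucSp n} {h : EucSp n → EReal}

lemma eventually_finite (hh : DPSingular F U x₀ h) :
    ∀ᶠ x in 𝓝[≠] x₀, h x₀ < h x ∧ h x ≠ ⊤ := by
  filter_upwards [nhdsWithin_le_nhds (hh.isOpen'.mem_nhds hh.mem), self_mem_nhdsWithin]
    with x hx hne
  exact ⟨hh.strictMin x hx hne, hh.subh.2.1 x hx⟩

lemma tendsto (hh : DPSingular F U x₀ h) : Tendsto h (𝓝[≠] x₀) (𝓝 (h x₀)) :=
  ((hh.cont.continuousAt (hh.isOpen'.mem_nhds hh.mem)).tendsto).mono_left nhdsWithin_le_nhds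

lemma tendsto_toReal_sub (hh : DPSingular F U x₀ h) (hx₀ : h x₀ ≠ ⊥) :
    Tendsto (fun x => (h x).toReal - (h x₀).toReal) (𝓝[≠] x₀) (𝓝 0) := by
  have := ((EReal.tendsto_toReal (hh.subh.2.1 x₀ hh.mem) hx₀).comp hh.tendsto).sub_const
    (h x₀).toReal
  rwa [sub_self] at this

lemma eventually_toReal_sub_pos (hh : DPSingular F U x₀ h) (hx₀ : h x₀ ≠ ⊥) :
    ∀ᶠ x in 𝓝[≠] x₀, 0 < (h x).toReal - (h x₀).toReal := by
  filter_upwards [hh.eventually_finite] with x hx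
  rw [sub_pos, ← EReal.coe_lt_coe_iff, EReal.coe_toReal (hh.subh.2.1 x₀ hh.mem) hx₀,
    EReal.coe_toReal hx.2 (bot_le.trans_lt hx.1).ne']
  exact hx.1

/-- A solution asymptotic to a finite type singularity is continuous at the singular point. -/
lemma continuousAt_of_finiteAsymp (hh : DPSingular F U x₀ h) (hx₀ : h x₀ ≠ ⊥) {H : EucSp n → ℝ}
    (hH : FiniteAsymp H h x₀) : ContinuousAt H x₀ := by
  rw [continuousAt_iff_punctured_nhds]
  have h1 := (Tendsto.mul hH (hh.tendsto_toReal_sub hx₀)).add_const (H x₀)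
  rw [mul_zero, zero_add] at h1
  refine h1.congr' ?_
  filter_upwards [hh.eventually_toReal_sub_pos hx₀] with x hx
  rw [div_mul_cancel₀ _ hx.ne', sub_add_cancel]

/-- Near a polar point, `(1 + ε) H₁ - H₂` tends to `-∞` for any two functions `H₁`, `H₂`
asymptotically equivalent to the singular function. -/
lemma eventually_lt_of_polarAsymp (hh : DPSingular F U x₀ h) (hx₀ : h x₀ = ⊥)
    {H₁ H₂ : EucSp n → ℝ} (h₁ : PolarAsymp H₁ h x₀) (h₂ : PolarAsymp H₂ h x₀) {ε : ℝ}
    (hε : 0 < ε) (K : ℝ) : ∀ᶠ x in 𝓝[≠] x₀, (1 + ε) * H₁ x - H₂ x < K := by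
  obtain ⟨C₁, hC₁⟩ := h₁
  obtain ⟨C₂, hC₂⟩ := h₂
  have hlim := hh.tendsto
  rw [hx₀] at hlim
  have hlt := EReal.tendsto_nhds_bot_iff_real.1 hlim ((K - (1 + ε) * C₁ - C₂) / ε)
  filter_upwards [hC₁, hC₂, hlt, hh.eventually_finite] with x a b c d
  rw [hx₀] at d
  lift h x to ℝ using ⟨d.2, d.1.ne'⟩ with r
  norm_cast at a b c
  rw [lt_div_iff₀ hε] at c
  nlinarith [mul_le_mul_of_nonneg_left a.2 (by linarith : 0 ≤ 1 + ε)]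

/-- At a finite type point `(1 + ε) H₁ - H₂` plus a smooth function has no local maximum. -/
lemma not_isLocalMax_of_finiteAsymp (hh : DPSingular F U x₀ h) (hx₀ : h x₀ ≠ ⊥)
    (hno : NoTestAt U h x₀) {H₁ H₂ : EucSp n → ℝ} (h₁ : FiniteAsymp H₁ h x₀)
    (h₂ : FiniteAsymp H₂ h x₀) {ε : ℝ} (hε : 0 < ε) {f : EucSp n → ℝ} (hf : ContDiff ℝ 2 f) :
    ¬ IsLocalMax (fun x => (1 + ε) * H₁ x - H₂ x + f x) x₀ := by
  intro hmax
  have hlim := (Tendsto.const_mul (1 + ε) h₁).sub h₂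
  have hgt := hlim.eventually_const_lt (u := ε / 2) (by linarith)
  refine hno (fun x => (h x₀).toReal + 2 / ε * (f x₀ - f x))
    ⟨(contDiff_const.add (contDiff_const.mul (contDiff_const.sub hf))).contDiffAt, ?_, ?_⟩
  · refine nhdsWithin_le_nhds ?_
    have hpt : ∀ᶠ x in 𝓝[≠] x₀, h x ≤ (((h x₀).toReal + 2 / ε * (f x₀ - f x) : ℝ) : EReal) := by
      filter_upwards [hgt, hh.eventually_toReal_sub_pos hx₀, nhdsWithin_le_nhds hmax,
        hh.eventually_finite] with x a b c d
      rw [← mul_div_assoc, ← sub_div, lt_div_iff₀ b] at a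
      rw [← EReal.coe_toReal d.2 (bot_le.trans_lt d.1).ne', EReal.coe_le_coe_iff,
        ← sub_le_iff_le_add', div_mul_eq_mul_div, le_div_iff₀ hε]
      have c' : (1 + ε) * H₁ x - H₂ x + f x ≤ (1 + ε) * H₁ x₀ - H₂ x₀ + f x₀ := c
      linarith
    rw [eventually_nhdsWithin_iff] at hpt
    filter_upwards [hpt] with x hx
    by_cases hxx : x = x₀
    · rw [hxx, sub_self, mul_zero, add_zero, EReal.coe_toReal (hh.subh.2.1 x₀ hh.mem) hx₀]
    · exact hx hxx
  · simp only [sub_self, mul_zero, add_zero, EReal.coe_toReal (hh.subh.2.1 x₀ hh.mem) hx₀]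

end DPSingular

/-- A solution of the Dirichlet problem with prescribed singularities lies below any other. -/
lemma IsDPPSSolution.le {k : ℕ} {F : ConeSubequation n} {Ω : Set (EucSp n)}
    (hΩ : IsOpen Ω) (hb : Bornology.IsBounded Ω) {x : Fin k → EucSp n}
    {φ : EucSp n → ℝ} (hφ : ContinuousOn φ (frontier Ω)) {U : Fin k → Set (EucSp n)}
    {h : Fin k → EucSp n → EReal} (hh : ∀ j, DPSingular F (U j) (x j) (h j))
    {H₁ H₂ : EucSp n → ℝ} (hH₁ : IsDPPSSolution F Ω x φ h H₁) (hH₂ : IsDPPSSolution F Ω x φ h H₂)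
    {y : EucSp n} (hy : y ∈ Ω) (hyx : y ∉ Set.range x) : H₁ y ≤ H₂ y := by
  by_contra! hlt
  obtain ⟨c₁, s₁, b₁, p₁, f₁⟩ := hH₁
  obtain ⟨c₂, s₂, b₂, p₂, f₂⟩ := hH₂
  have hcpt : IsCompact (closure Ω) := hb.isCompact_closure
  have hrange : IsClosed (Set.range x) := (Set.finite_range x).isClosed
  have hX : IsOpen (Ω \ Set.range x) := hΩ.sdiff hrange
  obtain ⟨R, hR⟩ := hcpt.isBounded.exists_norm_le
  obtain ⟨m, hm⟩ := (hcpt.of_isClosed_subset isClosed_frontier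
    frontier_subset_closure).exists_bound_of_continuousOn hφ
  set M := H₁ y - H₂ y with hM
  have hMpos : 0 < M := sub_pos.2 hlt
  set ε := M / (2 * (|m| + |H₁ y| + 1)) with hε
  have hεpos : 0 < ε := by positivity
  set τ := M / (4 * (R ^ 2 + 1)) with hτ
  have hτpos : 0 < τ := by positivity
  have hεM : ε * (|m| + |H₁ y|) < M / 2 := by
    have : ε * (|m| + |H₁ y| + 1) = M / 2 := by rw [hε]; field_simp
    linarith
  have hτM : τ * R ^ 2 < M / 4 := by
    have : τ * (R ^ 2 + 1) = M / 4 := by rw [hτ]; field_simp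
    linarith
  have hnorm : ∀ w ∈ closure Ω, τ * ‖w‖ ^ 2 ≤ τ * R ^ 2 := fun w hw => by
    gcongr
    exact hR w hw
  set W : EucSp n → ℝ := fun w => (1 + ε) * H₁ w - H₂ w + τ * ‖w‖ ^ 2 with hW
  have hWy : M - ε * |H₁ y| ≤ W y := by
    have := mul_le_mul_of_nonneg_left (neg_abs_le (H₁ y)) hεpos.le
    simp only [hW, hM]
    nlinarith [mul_nonneg hτpos.le (sq_nonneg ‖y‖)]
  have hfront : ∀ w ∈ frontier Ω, W w < W y := fun w hw => by
    have h1 := hnorm w (frontier_subset_closure hw)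
    have h2 : ε * φ w ≤ ε * |m| :=
      mul_le_mul_of_nonneg_left (((le_abs_self _).trans (hm w hw)).trans (le_abs_self m)) hεpos.le
    have h3 : W w = ε * φ w + τ * ‖w‖ ^ 2 := by
      simp only [hW, b₁ w hw, b₂ w hw]
      ring
    linarith
  have hpolar : ∀ j, ∃ V : Set (EucSp n), IsOpen V ∧ (h j (x j) = ⊥ → x j ∈ V) ∧
      ∀ w ∈ V, w ≠ x j → w ∈ closure Ω → W w < W y := fun j => by
    by_cases hj : h j (x j) = ⊥
    · have hev := (hh j).eventually_lt_of_polarAsymp hj (p₁ j hj) (p₂ j hj) hεpos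
        (W y - τ * R ^ 2)
      rw [eventually_nhdsWithin_iff, eventually_nhds_iff] at hev
      obtain ⟨V, hV, hVo, hxV⟩ := hev
      refine ⟨V, hVo, fun _ => hxV, fun w hw hne hcl => ?_⟩
      have h1 := hV w hw hne
      have h2 := hnorm w hcl
      simp only [hW] at h1 ⊢
      linarith
    · exact ⟨∅, isOpen_empty, fun h => absurd h hj, fun w hw => absurd hw (Set.notMem_empty w)⟩
  choose V hVo hxV hV using hpolar
  have hfin : ∀ j, x j ∉ V j → h j (x j) ≠ ⊥ := fun j hj hb => hj (hxV j hb)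
  have hcont : ∀ {H : EucSp n → ℝ}, ContinuousOn H (closure Ω \ Set.range x) →
      (∀ j, h j (x j) ≠ ⊥ → H (x j) = Filter.limsup H (𝓝[≠] (x j)) ∧ FiniteAsymp H (h j) (x j)) →
      ContinuousOn H (closure Ω \ ⋃ j, V j) := fun {H} hc hf w hw => by
    by_cases hwx : w ∈ Set.range x
    · obtain ⟨j, rfl⟩ := hwx
      have hj := hfin j fun hmem => hw.2 (Set.mem_iUnion.2 ⟨j, hmem⟩)
      exact ((hh j).continuousAt_of_finiteAsymp hj (hf j hj).2).continuousWithinAt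
    · refine (hc w ⟨hw.1, hwx⟩).mono_of_mem_nhdsWithin ?_
      filter_upwards [self_mem_nhdsWithin, nhdsWithin_le_nhds (hrange.isOpen_compl.mem_nhds hwx)]
        with a ha hax
      exact ⟨ha.1, hax⟩
  have hcW : ContinuousOn W (closure Ω \ ⋃ j, V j) := by
    refine (ContinuousOn.sub (continuousOn_const.mul ?_) ?_).add
      (continuous_const.mul (continuous_norm.pow 2)).continuousOn
    · exact hcont c₁ f₁
    · exact hcont c₂ f₂
  have hyK : y ∈ closure Ω \ ⋃ j, V j := by
    refine ⟨subset_closure hy, fun hmem => ?_⟩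
    obtain ⟨j, hj⟩ := Set.mem_iUnion.1 hmem
    exact lt_irrefl _ (hV j y hj (fun e => hyx ⟨j, e.symm⟩) (subset_closure hy))
  obtain ⟨z, ⟨hzc, hzV⟩, hz⟩ := (hcpt.diff (isOpen_iUnion hVo)).exists_isMaxOn ⟨y, hyK⟩ hcW
  have hzy : W y ≤ W z := hz hyK
  have hzΩ : z ∈ Ω := by
    by_contra hzn
    exact (hfront z (hΩ.frontier_eq ▸ ⟨hzc, hzn⟩)).not_ge hzy
  have hnear : ∀ᶠ w in 𝓝 z, (∀ j, w ∈ V j → w ≠ x j) → W w ≤ W z := by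
    filter_upwards [hΩ.mem_nhds hzΩ] with w hw hwne
    by_cases hwV : w ∈ ⋃ j, V j
    · obtain ⟨j, hj⟩ := Set.mem_iUnion.1 hwV
      exact ((hV j w hj (hwne j hj) (subset_closure hw)).trans_le hzy).le
    · exact hz ⟨subset_closure hw, hwV⟩
  have hmax : IsLocalMax W z := by
    have hne : ∀ᶠ w in 𝓝 z, ∀ j, x j ∈ V j → w ≠ x j := by
      rw [eventually_all]
      intro j
      by_cases hj : x j ∈ V j
      · have : z ≠ x j := fun e => hzV (Set.mem_iUnion.2 ⟨j, e ▸ hj⟩)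
        exact (eventually_ne_nhds this).mono fun w hw _ => hw
      · exact Eventually.of_forall fun w hj' => absurd hj' hj
    filter_upwards [hnear, hne] with w h1 h2
    exact h1 fun j hj e => h2 j (e ▸ hj) e
  by_cases hzx : z ∈ Set.range x
  · obtain ⟨j, rfl⟩ := hzx
    have hj := hfin j fun hmem => hzV (Set.mem_iUnion.2 ⟨j, hmem⟩)
    exact (hh j).not_isLocalMax_of_finiteAsymp hj ((hh j).polarOrFinite.resolve_left hj).2
      (f₁ j hj).2 (f₂ j hj).2 hεpos (contDiff_const.mul (contDiff_norm_sq ℝ)) hmax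
  · have hsub : Ω \ Set.range x ⊆ closure Ω \ Set.range x :=
      Set.sdiff_subset_sdiff_left subset_closure
    refine F.not_isLocalMax hX (u := fun w => (1 + ε) * H₁ w) (v := fun w => -H₂ w)
      (continuousOn_const.mul (c₁.mono hsub)) (c₂.mono hsub).neg
      (fun w hw ψ hψ => F.hessMatrix_mem_of_isTestAt_const_mul s₁.1.2.2 (by positivity) hw hψ)
      (fun w hw ψ hψ => s₂.2.2.2 w hw ψ ?_) hτpos ⟨hzΩ, hzx⟩ ?_
    · simpa only [EReal.coe_neg] using hψ
    · simpa only [hW, sub_eq_add_neg] using hmax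

/-- Uniqueness for the DPPS: there is at most one solution of the Dirichlet
problem with prescribed interior singularities. -/
theorem dirichlet_singularities_stmt3 {n k : ℕ} (F : ConeSubequation n)
    (Ω : Set (EucSp n)) (hΩ : IsBoundedDomain Ω)
    (x : Fin k → EucSp n) (hx : ∀ j, x j ∈ Ω) (hinj : Function.Injective x)
    (φ : EucSp n → ℝ) (hφ : ContinuousOn φ (frontier Ω))
    (U : Fin k → Set (EucSp n)) (h : Fin k → EucSp n → EReal)
    (hh : ∀ j, DPSingular F (U j) (x j) (h j))
    (H₁ H₂ : EucSp n → ℝ)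
    (hH₁ : IsDPPSSolution F Ω x φ h H₁) (hH₂ : IsDPPSSolution F Ω x φ h H₂) :
    Set.EqOn H₁ H₂ (closure Ω \ Set.range x) := by
  rintro y ⟨hy, hyx⟩
  by_cases hyΩ : y ∈ Ω
  · exact le_antisymm (hH₁.le hΩ.1 hΩ.2.2 hφ hh hH₂ hyΩ hyx)
      (hH₂.le hΩ.1 hΩ.2.2 hφ hh hH₁ hyΩ hyx)
  · have hyf : y ∈ frontier Ω := hΩ.1.frontier_eq ▸ ⟨hy, hyΩ⟩
    rw [hH₁.2.2.1 y hyf, hH₂.2.2.1 y hyf]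
end
end
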